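/- arXiv:1110.0082 — 3 statements merged into one kernel-verified Lean document; each statement's English description precedes it below -/
import Mathlib

section
/- Suppose that G is a non-locally compact, k-gentle Tychonoff paratopological group, and Y = bG \ G is the remainder of G in some Hausdorff compactification bG of G. If Y has a point-countable base and a Gδ-diagonal, then G, bG and Y are separable and metrizable spaces. -/
open Filter Topology Set

/-- A sequence of families of open sets of `X`, each covering `Y`, which together distinguish the
points of `Y`. -/
structure IsDiagonalSequence {X : Type*} [TopologicalSpace X] (Y : Set X)
    (S : ℕ → Set (Set X)) : Prop where
  isOpen : ∀ n, ∀ U ∈ S n, IsOpen U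
  covers : ∀ n, ∀ y ∈ Y, ∃ U ∈ S n, y ∈ U
  eq_of_mem : ∀ y ∈ Y, ∀ z ∈ Y, (∀ n, ∃ U ∈ S n, y ∈ U ∧ z ∈ U) → y = z

/-- A countable family of nonempty open sets such that every nonempty open set contains one of
its members. -/
structure IsCountablePiBase {X : Type*} [TopologicalSpace X] (P : Set (Set X)) : Prop where
  countable : P.Countable
  isOpen : ∀ E ∈ P, IsOpen E
  nonempty : ∀ E ∈ P, E.Nonempty
  exists_subset : ∀ O : Set X, IsOpen O → O.Nonempty → ∃ E ∈ P, E ⊆ O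

section CompactHausdorff

variable {X : Type*} [TopologicalSpace X]

theorem exists_isDiagonalSequence {Y : Set X} (h : IsGδ (diagonal Y)) :
    ∃ S : ℕ → Set (Set X), IsDiagonalSequence Y S := by
  obtain ⟨O, hO, hOeq⟩ := h.eq_iInter_nat
  refine ⟨fun n => {U | IsOpen U ∧ ∀ y z : Y, (y : X) ∈ U → (z : X) ∈ U → (y, z) ∈ O n},
    fun n U hU => hU.1, fun n y hy => ?_, fun y hy z hz hyz => ?_⟩
  · have hmem : ((⟨y, hy⟩ : Y), (⟨y, hy⟩ : Y)) ∈ O n :=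
      mem_iInter.1 (hOeq ▸ mem_diagonal (⟨y, hy⟩ : Y)) n
    obtain ⟨u, v, hu, hv, hyu, hyv, huv⟩ := isOpen_prod_iff.1 (hO n) _ _ hmem
    obtain ⟨U, hU, hUeq⟩ := isOpen_induced_iff.1 (hu.inter hv)
    have hmemU : ∀ a : Y, (a : X) ∈ U ↔ a ∈ u ∩ v := fun a => by rw [← hUeq]; rfl
    exact ⟨U, ⟨hU, fun a b ha hb => huv ⟨((hmemU a).1 ha).1, ((hmemU b).1 hb).2⟩⟩,
      (hmemU ⟨y, hy⟩).2 ⟨hyu, hyv⟩⟩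
  · have : ((⟨y, hy⟩ : Y), (⟨z, hz⟩ : Y)) ∈ diagonal Y := by
      rw [hOeq]
      refine mem_iInter.2 fun n => ?_
      obtain ⟨U, hU, h1, h2⟩ := hyz n
      exact hU.2 _ _ h1 h2
    exact congrArg Subtype.val (mem_diagonal_iff.1 this)

theorem IsCountablePiBase.secondCountableTopology {Y : Set X} {B : Set (Set Y)} {P : Set (Set X)}
    (hP : IsCountablePiBase P) (hY : Dense Y) (hB : TopologicalSpace.IsTopologicalBasis B)
    (hpc : ∀ y, {b ∈ B | y ∈ b}.Countable) : SecondCountableTopology Y := by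
  have : Countable P := hP.countable.to_subtype
  choose p hp using fun E : P => hY.inter_open_nonempty E (hP.isOpen E E.2) (hP.nonempty E E.2)
  refine hB.secondCountableTopology (Countable.mono ?_
    ((countable_iUnion fun E : P => hpc ⟨p E, (hp E).2⟩).insert ∅))
  intro b hb
  rcases b.eq_empty_or_nonempty with h | ⟨y, hy⟩
  · exact Or.inl h
  obtain ⟨Q, hQ, rfl⟩ := isOpen_induced_iff.1 (hB.isOpen hb)
  obtain ⟨E, hE, hEQ⟩ := hP.exists_subset Q hQ ⟨y, hy⟩
  exact Or.inr (mem_iUnion.2 ⟨⟨E, hE⟩, hb, hEQ (hp ⟨E, hE⟩).1⟩)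

/-- A space with a dense second countable subspace has a countable π-base, if it is regular. -/
theorem exists_isCountablePiBase_of_denseRange [RegularSpace X] {Z : Type*} [TopologicalSpace Z]
    [SecondCountableTopology Z] {f : Z → X} (hf : IsInducing f) (hd : DenseRange f) :
    ∃ P : Set (Set X), IsCountablePiBase P := by
  refine ⟨(fun b => interior (closure (f '' b))) '' TopologicalSpace.countableBasis Z,
    (TopologicalSpace.countable_countableBasis Z).image _, ?_, ?_, fun O hO hOne => ?_⟩
  · rintro _ ⟨b, -, rfl⟩
    exact isOpen_interior
  · rintro _ ⟨b, hb, rfl⟩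
    obtain ⟨Q, hQ, rfl⟩ := hf.isOpen_iff.1 (TopologicalSpace.isOpen_of_mem_countableBasis hb)
    obtain ⟨z, hz⟩ := TopologicalSpace.nonempty_of_mem_countableBasis hb
    refine ⟨f z, interior_maximal ?_ hQ hz⟩
    rw [image_preimage_eq_inter_range]
    exact hd.open_subset_closure_inter hQ
  · obtain ⟨x, hx⟩ := hOne
    obtain ⟨C, hC, hCc, hCO⟩ := exists_mem_nhds_isClosed_subset (hO.mem_nhds hx)
    obtain ⟨z, hz⟩ := hd.exists_mem_open isOpen_interior ⟨x, mem_interior_iff_mem_nhds.2 hC⟩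
    obtain ⟨b, hb, -, hbC⟩ := (TopologicalSpace.isBasis_countableBasis Z).exists_subset_of_mem_open
      (show z ∈ f ⁻¹' interior C from hz) (isOpen_interior.preimage hf.continuous)
    exact ⟨_, mem_image_of_mem _ hb, interior_subset.trans ((closure_minimal
      ((image_subset_iff.2 hbC).trans interior_subset) hCc).trans hCO)⟩

variable [CompactSpace X] [T2Space X]

theorem exists_isClosed_isGδ_subset {x : X} {U : Set X} (hU : IsOpen U) (hx : x ∈ U) :
    ∃ C, IsClosed C ∧ IsGδ C ∧ x ∈ C ∧ C ⊆ U := by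
  obtain ⟨φ, h0, h1, -⟩ := exists_continuous_zero_one_of_isClosed (isClosed_singleton (x := x))
    hU.isClosed_compl (by simpa using hx)
  refine ⟨φ ⁻¹' {0}, isClosed_singleton.preimage φ.continuous,
    (isClosed_singleton.isGδ).preimage φ.continuous, h0 rfl, fun y hy => ?_⟩
  by_contra hyU
  have := h1 hyU
  simp_all

theorem exists_antitone_open_outer_base {F : Set X} (hF : IsClosed F) (hG : IsGδ F) :
    ∃ R : ℕ → Set X, Antitone R ∧ (∀ n, IsOpen (R n)) ∧ (∀ n, F ⊆ R n) ∧
      ∀ U, IsOpen U → F ⊆ U → ∃ n, R n ⊆ U := by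
  obtain ⟨O, hO, hOeq⟩ := hG.eq_iInter_nat
  choose Q hQ hFQ hQO using fun n => normal_exists_closure_subset hF (hO n)
    (hOeq ▸ iInter_subset O n)
  refine ⟨fun n => ⋂ i ∈ Iic n, Q i, fun m n hmn => biInter_subset_biInter_left (Iic_subset_Iic.2 hmn),
    fun n => (finite_Iic n).isOpen_biInter fun i _ => hQ i, fun n => subset_iInter₂ fun i _ => hFQ i,
    fun U hU hFU => ?_⟩
  obtain ⟨t, ht⟩ := hU.isClosed_compl.isCompact.elim_finite_subfamily_closed
    (fun n => closure (Q n)) (fun n => isClosed_closure) (by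
      rw [← disjoint_iff_inter_eq_empty, disjoint_compl_left_iff_subset]
      refine Subset.trans ?_ hFU
      rw [hOeq]
      exact iInter_mono hQO)
  rw [← disjoint_iff_inter_eq_empty, disjoint_compl_left_iff_subset] at ht
  refine ⟨t.sup id, Subset.trans (fun x hx => ?_) ht⟩
  simp only [mem_iInter, mem_Iic] at hx ⊢
  exact fun i hi => subset_closure (hx i (Finset.le_sup (f := id) hi))

/-- A compact set contained in a space with a diagonal sequence is separable. -/
theorem IsDiagonalSequence.exists_countable_dense {Y : Set X} {S : ℕ → Set (Set X)}
    (hS : IsDiagonalSequence Y S) {K : Set X} (hK : IsCompact K) (hKY : K ⊆ Y) :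
    ∃ D, D.Countable ∧ D ⊆ K ∧ K ⊆ closure D := by
  have hcov : ∀ n, ∃ T : Set (Set X), T.Finite ∧ (∀ C ∈ T, IsClosed C ∧ ∃ U ∈ S n, C ⊆ U) ∧
      K ⊆ ⋃₀ T := by
    intro n
    have : ∀ x ∈ K, ∃ C, C ∈ 𝓝 x ∧ IsClosed C ∧ ∃ U ∈ S n, C ⊆ U := by
      intro x hx
      obtain ⟨U, hU, hxU⟩ := hS.covers n x (hKY hx)
      obtain ⟨C, hC, hCc, hCU⟩ := exists_mem_nhds_isClosed_subset ((hS.isOpen n U hU).mem_nhds hxU)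
      exact ⟨C, hC, hCc, U, hU, hCU⟩
    choose! C hC hC' using this
    obtain ⟨t, htK, ht⟩ := hK.elim_nhds_subcover C hC
    refine ⟨C '' t, t.finite_toSet.image C, ?_, by simpa using ht⟩
    rintro _ ⟨x, hx, rfl⟩
    exact hC' x (htK x hx)
  choose T hTfin hT hTK using hcov
  have hcount : {s : Set (Set X) | s.Finite ∧ s ⊆ ⋃ n, T n}.Countable :=
    countable_ofPred_finite_subset (countable_iUnion fun n => (hTfin n).countable)
  let I : Set (Set (Set X)) := {s | (s.Finite ∧ s ⊆ ⋃ n, T n) ∧ (K ∩ ⋂₀ s).Nonempty}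
  have hI : I.Countable := hcount.mono fun s hs => hs.1
  have : Countable I := hI.to_subtype
  choose p hp using fun s : I => s.2.2
  refine ⟨range p, countable_range p, range_subset_iff.2 fun s => (hp s).1, fun x hx => ?_⟩
  rw [mem_closure_iff]
  intro V hV hxV
  choose C hCT hxC using fun n => mem_sUnion.1 (hTK n hx)
  obtain ⟨t, ht⟩ := (hK.inter_right hV.isClosed_compl).elim_finite_subfamily_closed
    C (fun n => (hT n _ (hCT n)).1) (by
      rw [eq_empty_iff_forall_notMem]
      rintro z ⟨⟨hzK, hzV⟩, hz⟩
      refine hzV ((hS.eq_of_mem x (hKY hx) z (hKY hzK) fun n => ?_) ▸ hxV)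
      obtain ⟨U, hU, hCU⟩ := (hT n _ (hCT n)).2
      exact ⟨U, hU, hCU (hxC n), hCU (mem_iInter.1 hz n)⟩)
  let s : I := ⟨C '' t, ⟨t.finite_toSet.image C, image_subset_iff.2 fun n _ =>
    mem_iUnion.2 ⟨n, hCT n⟩⟩, x, hx, by simpa using fun n _ => hxC n⟩
  refine ⟨p s, ?_, mem_range_self s⟩
  by_contra hps
  have h1 := hp s
  have : p s ∈ K ∩ Vᶜ ∩ ⋂ i ∈ t, C i := ⟨⟨h1.1, hps⟩, by simpa [s] using h1.2⟩
  rw [ht] at this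
  exact this

section PointCountable

variable {Y : Set X} {B : Set (Set Y)}

theorem exists_countable_outer_base (hY : Dense Y) (hB : TopologicalSpace.IsTopologicalBasis B)
    (hpc : ∀ y, {b ∈ B | y ∈ b}.Countable) {K D : Set X} (hK : IsCompact K) (hKY : K ⊆ Y)
    (hD : D.Countable) (hDK : D ⊆ K) (hKD : K ⊆ closure D) :
    ∃ W : Set (Set X), W.Countable ∧ (∀ w ∈ W, IsOpen w ∧ K ⊆ w) ∧
      ∀ O, IsOpen O → K ⊆ O → ∃ w ∈ W, w ⊆ O := by
  let BD : Set (Set Y) := ⋃ d ∈ Subtype.val ⁻¹' D, {b ∈ B | d ∈ b}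
  have hBD : BD.Countable :=
    (hD.preimage Subtype.val_injective).biUnion fun d _ => hpc d
  have hcount := countable_ofPred_finite_subset hBD
  let w : Set (Set Y) → Set X := fun t => interior (closure (Subtype.val '' ⋃₀ t))
  refine ⟨{u ∈ w '' {t | t.Finite ∧ t ⊆ BD} | K ⊆ u}, (hcount.image w).mono (sep_subset _ _),
    ?_, fun O hO hKO => ?_⟩
  · rintro _ ⟨⟨t, -, rfl⟩, hKt⟩
    exact ⟨isOpen_interior, hKt⟩
  obtain ⟨O', hO', hKO', hO'O⟩ := normal_exists_closure_subset hK.isClosed hO hKO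
  have hex : ∀ x ∈ K, ∃ b ∈ BD, Subtype.val '' b ⊆ O' ∧ ∃ Q, IsOpen Q ∧ x ∈ Q ∧
      Subtype.val ⁻¹' Q = b := by
    intro x hx
    obtain ⟨b, hbB, hxb, hbO⟩ := hB.exists_subset_of_mem_open
      (show (⟨x, hKY hx⟩ : Y) ∈ Subtype.val ⁻¹' O' from hKO' hx)
      (hO'.preimage continuous_subtype_val)
    obtain ⟨Q, hQ, rfl⟩ := isOpen_induced_iff.1 (hB.isOpen hbB)
    obtain ⟨d, hdQ, hdD⟩ := mem_closure_iff.1 (hKD hx) Q hQ hxb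
    refine ⟨_, ?_, image_subset_iff.2 hbO, Q, hQ, hxb, rfl⟩
    simp only [BD, mem_iUnion]
    exact ⟨⟨d, hKY (hDK hdD)⟩, hdD, hbB, hdQ⟩
  choose! b hbBD hbO Q hQ hxQ hQb using hex
  obtain ⟨t, htK, ht⟩ := hK.elim_nhds_subcover Q fun x hx => (hQ x hx).mem_nhds (hxQ x hx)
  refine ⟨w (b '' t), ⟨mem_image_of_mem w ⟨t.finite_toSet.image b,
    image_subset_iff.2 fun x hx => hbBD x (htK x hx)⟩, ?_⟩, ?_⟩
  · refine ht.trans (interior_maximal ?_ (isOpen_biUnion fun x hx => hQ x (htK x hx)))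
    refine iUnion₂_subset fun x hx => ?_
    refine (hY.open_subset_closure_inter (hQ x (htK x hx))).trans (closure_mono ?_)
    rintro y ⟨hyQ, hyY⟩
    refine ⟨⟨y, hyY⟩, ⟨b x, mem_image_of_mem b hx, ?_⟩, rfl⟩
    rw [← hQb x (htK x hx)]
    exact hyQ
  · refine interior_subset.trans (Subset.trans (closure_mono ?_) hO'O)
    rw [image_subset_iff, sUnion_subset_iff]
    rintro _ ⟨x, hx, rfl⟩
    exact image_subset_iff.1 (hbO x (htK x hx))

theorem isLindelof_compl_of_pointCountable (hY : Dense Y)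
    (hB : TopologicalSpace.IsTopologicalBasis B) (hpc : ∀ y, {b ∈ B | y ∈ b}.Countable)
    {S : ℕ → Set (Set X)} (hS : IsDiagonalSequence Y S) : IsLindelof Yᶜ := by
  refine isLindelof_of_countable_subcover fun {ι} U hU hcov => ?_
  let K : Set X := (⋃ i, U i)ᶜ
  have hK : IsCompact K := (isOpen_iUnion hU).isClosed_compl.isCompact
  have hKY : K ⊆ Y := by rwa [compl_subset_comm]
  obtain ⟨D, hD, hDK, hKD⟩ := hS.exists_countable_dense hK hKY
  obtain ⟨W, hW, hWo, hWb⟩ := exists_countable_outer_base hY hB hpc hK hKY hD hDK hKD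
  have hfin : ∀ w ∈ W, ∃ t : Finset ι, wᶜ ⊆ ⋃ i ∈ t, U i := fun w hw =>
    (hWo w hw).1.isClosed_compl.isCompact.elim_finite_subcover U hU
      (compl_subset_comm.1 (hWo w hw).2)
  choose! t ht using hfin
  refine ⟨⋃ w ∈ W, t w, hW.biUnion fun w _ => (t w).countable_toSet, fun x hx => ?_⟩
  have hxK : K ⊆ {x}ᶜ := by
    rintro y hy rfl
    exact hy (hcov hx)
  obtain ⟨w, hw, hwx⟩ := hWb _ isOpen_compl_singleton hxK
  obtain ⟨i, hi, hxi⟩ := mem_iUnion₂.1 (ht w hw (show x ∈ wᶜ from fun h => hwx h rfl))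
  exact mem_iUnion₂.2 ⟨i, mem_biUnion hw hi, hxi⟩

end PointCountable

theorem exists_isClosed_isGδ_disjoint {Y : Set X} [SecondCountableTopology Y] {x : X}
    (hx : x ∉ Y) : ∃ C, IsClosed C ∧ IsGδ C ∧ x ∈ C ∧ Disjoint C Y := by
  have hex : ∀ y : Y, ∃ O C : Set X, IsOpen O ∧ (y : X) ∈ O ∧ IsClosed C ∧ IsGδ C ∧ x ∈ C ∧
      Disjoint C O := by
    intro y
    obtain ⟨O, V, hO, hV, hyO, hxV, hOV⟩ := t2_separation (show (y : X) ≠ x by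
      rintro rfl
      exact hx y.2)
    obtain ⟨C, hC, hCG, hxC, hCV⟩ := exists_isClosed_isGδ_subset hV hxV
    exact ⟨O, C, hO, hyO, hC, hCG, hxC, hOV.symm.mono_left hCV⟩
  choose O C hO hyO hC hCG hxC hCO using hex
  obtain ⟨s, hs, hcov⟩ := TopologicalSpace.countable_cover_nhds (f := fun y : Y =>
    Subtype.val ⁻¹' O y) fun y => ((hO y).preimage continuous_subtype_val).mem_nhds (hyO y)
  refine ⟨⋂ y ∈ s, C y, isClosed_biInter fun y _ => hC y, .biInter hs fun y _ => hCG y,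
    mem_iInter₂.2 fun y _ => hxC y, disjoint_left.2 fun z hz hzY => ?_⟩
  obtain ⟨y, hy, hzy⟩ := mem_iUnion₂.1 (hcov.ge (mem_univ (⟨z, hzY⟩ : Y)))
  exact disjoint_left.1 (hCO y) (mem_iInter₂.1 hz y hy) hzy

theorem IsDiagonalSequence.exists_forall_notMem {Y : Set X} {S : ℕ → Set (Set X)}
    (hS : IsDiagonalSequence Y S)
    (hY : ∀ C, IsClosed C → IsGδ C → C.Nonempty → (C ∩ Y).Nonempty) {x : X} (hx : x ∉ Y) :
    ∃ n, ∀ U ∈ S n, x ∉ U := by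
  by_contra! hcon
  choose U hU hxU using hcon
  choose C hC hCG hxC hCU using fun n => exists_isClosed_isGδ_subset (hS.isOpen n _ (hU n)) (hxU n)
  have hP : IsClosed (⋂ n, C n) := isClosed_iInter hC
  have hPG : IsGδ (⋂ n, C n) := .iInter hCG
  have hxP : x ∈ ⋂ n, C n := mem_iInter.2 hxC
  obtain ⟨y, hyP, hyY⟩ := hY _ hP hPG ⟨x, hxP⟩
  obtain ⟨C', hC', hCG', hxC', hCy⟩ := exists_isClosed_isGδ_subset
    (isOpen_compl_singleton (x := y)) (show x ∈ ({y} : Set X)ᶜ by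
      rintro rfl
      exact hx hyY)
  obtain ⟨z, ⟨hzP, hzC'⟩, hzY⟩ := hY _ (hP.inter hC') (hPG.inter hCG') ⟨x, hxP, hxC'⟩
  exact hCy hzC' (hS.eq_of_mem z hzY y hyY fun n =>
    ⟨U n, hU n, hCU n (mem_iInter.1 hzP n), hCU n (mem_iInter.1 hyP n)⟩)

/-- If all disjoint families of nonempty open sets are countable, and `Y` has a diagonal sequence
whose unions intersect in `Y`, then the ambient space has a countable π-base. -/
theorem IsDiagonalSequence.exists_isCountablePiBase {Y : Set X} {S : ℕ → Set (Set X)}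
    (hS : IsDiagonalSequence Y S) (hYd : Dense Y) (hY : ∀ x ∉ Y, ∃ n, ∀ U ∈ S n, x ∉ U)
    (hccc : ∀ V : Set (Set X), (∀ v ∈ V, IsOpen v ∧ v.Nonempty) → V.PairwiseDisjoint id →
      V.Countable) : ∃ P : Set (Set X), IsCountablePiBase P := by
  have hmax : ∀ n, ∃ V : Set (Set X), V.Countable ∧
      (∀ v ∈ V, IsOpen v ∧ ∃ U ∈ S n, closure v ⊆ U) ∧ Dense (⋃₀ V) := by
    intro n
    let good : Set (Set X) := {v | (IsOpen v ∧ v.Nonempty) ∧ ∃ U ∈ S n, closure v ⊆ U}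
    obtain ⟨V, hV⟩ := zorn_subset {V : Set (Set X) | V ⊆ good ∧ V.PairwiseDisjoint id}
      fun c hc hch => ⟨⋃₀ c, ⟨sUnion_subset fun V hV => (hc hV).1,
        (pairwiseDisjoint_sUnion hch.directedOn).2 fun V hV => (hc hV).2⟩,
        fun V hV => subset_sUnion_of_mem hV⟩
    refine ⟨V, hccc V (fun v hv => (hV.prop.1 hv).1) hV.prop.2,
      fun v hv => ⟨(hV.prop.1 hv).1.1, (hV.prop.1 hv).2⟩, ?_⟩
    rw [dense_iff_inter_open]
    intro O hO hOne
    by_contra hdis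
    obtain ⟨y, hyO, hyY⟩ := hYd.inter_open_nonempty O hO hOne
    obtain ⟨U, hU, hyU⟩ := hS.covers n y hyY
    obtain ⟨v, hv, hyv, hvU⟩ := normal_exists_closure_subset (isClosed_singleton (x := y))
      (hO.inter (hS.isOpen n U hU)) (by simpa using ⟨hyO, hyU⟩)
    rw [singleton_subset_iff] at hyv
    have hvO : v ⊆ O := subset_closure.trans (hvU.trans inter_subset_left)
    have hvdis : ∀ u ∈ V, Disjoint v u := fun u hu => disjoint_left.2 fun z hzv hzu =>
      hdis ⟨z, hvO hzv, u, hu, hzu⟩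
    have hmem : v ∈ V := by
      refine hV.le_of_ge (y := insert v V) ⟨insert_subset ⟨⟨hv, y, hyv⟩, U, hU,
        hvU.trans inter_subset_right⟩ hV.prop.1, ?_⟩ (subset_insert v V) (mem_insert v V)
      exact hV.prop.2.insert fun u hu _ => hvdis u hu
    exact disjoint_left.1 (hvdis v hmem) hyv hyv
  choose V hVc hV hVd using hmax
  have hD : Dense (⋂ n, ⋃₀ V n) := dense_iInter_of_isOpen
    (fun n => isOpen_sUnion fun v hv => (hV n v hv).1) hVd
  have hcount := countable_ofPred_finite_subset (countable_iUnion hVc)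
  refine ⟨{E ∈ (fun s => ⋂₀ s) '' {s : Set (Set X) | s.Finite ∧ s ⊆ ⋃ n, V n} | E.Nonempty},
    (hcount.image _).mono (sep_subset _ _), ?_, fun E hE => hE.2, fun O hO hOne => ?_⟩
  · rintro _ ⟨⟨s, ⟨hs, hsV⟩, rfl⟩, -⟩
    refine hs.isOpen_sInter fun v hv => ?_
    obtain ⟨n, hn⟩ := mem_iUnion.1 (hsV hv)
    exact (hV n v hn).1
  obtain ⟨d, hdO, hd⟩ := hD.inter_open_nonempty O hO hOne
  choose v hvV hdv using fun n => mem_sUnion.1 (mem_iInter.1 hd n)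
  choose hvo U hU hvU using fun n => hV n (v n) (hvV n)
  have hsub : ∀ z, z ∈ ⋂ n, closure (v n) → z ∈ Y := by
    intro z hz
    by_contra hzY
    obtain ⟨n, hn⟩ := hY z hzY
    exact hn _ (hU n) (hvU n (mem_iInter.1 hz n))
  have hdc : d ∈ ⋂ n, closure (v n) := mem_iInter.2 fun n => subset_closure (hdv n)
  obtain ⟨t, ht⟩ := hO.isClosed_compl.isCompact.elim_finite_subfamily_closed
    (fun n => closure (v n)) (fun n => isClosed_closure) (by
      rw [eq_empty_iff_forall_notMem]
      rintro z ⟨hzO, hz⟩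
      refine hzO ((hS.eq_of_mem d (hsub d hdc) z (hsub z hz) fun n => ?_) ▸ hdO)
      exact ⟨U n, hU n, hvU n (mem_iInter.1 hdc n), hvU n (mem_iInter.1 hz n)⟩)
  rw [← disjoint_iff_inter_eq_empty, disjoint_compl_left_iff_subset] at ht
  refine ⟨⋂₀ (v '' t), ⟨⟨_, ⟨t.finite_toSet.image v, image_subset_iff.2 fun n _ =>
    mem_iUnion.2 ⟨n, hvV n⟩⟩, rfl⟩, d, by simpa using fun n _ => hdv n⟩, Subset.trans ?_ ht⟩
  simpa using fun n hn => (biInter_subset_of_mem (s := (t : Set ℕ)) (t := v) hn).trans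
    subset_closure

/-- A compact Hausdorff space with a countable network is metrizable. -/
theorem metrizableSpace_of_countable_network {N : Set (Set X)} (hN : N.Countable)
    (hnet : ∀ x U, IsOpen U → x ∈ U → ∃ n ∈ N, x ∈ n ∧ n ⊆ U) :
    TopologicalSpace.MetrizableSpace X := by
  let I : Set (Set X × Set X) := {p ∈ N ×ˢ N | Disjoint (closure p.1) (closure p.2)}
  have hI : I.Countable := (hN.prod hN).mono (sep_subset _ _)
  have : Countable I := hI.to_subtype
  choose φ h0 h1 _ using fun p : I => exists_continuous_zero_one_of_isClosed
    (isClosed_closure (s := p.1.1)) (isClosed_closure (s := p.1.2)) p.2.2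
  have hsep : Pairwise fun x y => ∃ p : I, φ p x ≠ φ p y := by
    intro x y hxy
    obtain ⟨u, hxu, hu, v, hyv, hv, huv⟩ := exists_open_nhds_disjoint_closure hxy
    obtain ⟨a, haN, hxa, hau⟩ := hnet x u hu hxu
    obtain ⟨b, hbN, hyb, hbv⟩ := hnet y v hv hyv
    let p : I := ⟨(a, b), ⟨haN, hbN⟩, huv.mono (closure_mono hau) (closure_mono hbv)⟩
    refine ⟨p, ?_⟩
    rw [h0 p (subset_closure hxa), h1 p (subset_closure hyb)]
    simp
  have := Encodable.ofCountable I
  exact Metric.PiNatEmbed.TopologicalSpace.MetrizableSpace.of_countable_separating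
    (Y := fun _ => ℝ) (fun p : I => φ p) (fun p => (φ p).continuous) hsep

/-- A compact Hausdorff space is metrizable if it is the union of a second countable subspace and
a continuous image of a second countable space. -/
theorem metrizableSpace_of_secondCountable {Z : Type*} [TopologicalSpace Z]
    [SecondCountableTopology Z] {f : Z → X} (hf : Continuous f)
    [SecondCountableTopology ((range f)ᶜ : Set X)] : TopologicalSpace.MetrizableSpace X := by
  refine metrizableSpace_of_countable_network
    (N := (fun b => f '' b) '' TopologicalSpace.countableBasis Z ∪
      (fun b => Subtype.val '' b) '' TopologicalSpace.countableBasis ((range f)ᶜ : Set X))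
    (((TopologicalSpace.countable_countableBasis _).image _).union
      ((TopologicalSpace.countable_countableBasis _).image _)) fun x U hU hx => ?_
  by_cases hxf : x ∈ range f
  · obtain ⟨z, rfl⟩ := hxf
    obtain ⟨b, hb, hzb, hbU⟩ := (TopologicalSpace.isBasis_countableBasis Z).exists_subset_of_mem_open
      (show z ∈ f ⁻¹' U from hx) (hU.preimage hf)
    exact ⟨_, Or.inl (mem_image_of_mem _ hb), mem_image_of_mem f hzb, image_subset_iff.2 hbU⟩
  · obtain ⟨b, hb, hxb, hbU⟩ := (TopologicalSpace.isBasis_countableBasis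
      ((range f)ᶜ : Set X)).exists_subset_of_mem_open
      (show (⟨x, hxf⟩ : ((range f)ᶜ : Set X)) ∈ Subtype.val ⁻¹' U from hx)
      (hU.preimage continuous_subtype_val)
    exact ⟨_, Or.inr (mem_image_of_mem _ hb), ⟨_, hxb, rfl⟩, image_subset_iff.2 hbU⟩

end CompactHausdorff

section ParatopologicalGroup

variable {G : Type*} [Group G] [TopologicalSpace G]

theorem continuousOn_inv_of_isCompact_image_inv [T2Space G]
    (hk : ∀ F : Set G, IsCompact F → IsCompact ((fun x : G => x⁻¹) '' F)) {K : Set G}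
    (hK : IsCompact K) : ContinuousOn (fun x : G => x⁻¹) K := by
  refine continuousOn_iff_isClosed.2 fun t ht =>
    ⟨_, (hk _ ((hk K hK).inter_left ht)).isClosed, ?_⟩
  ext x
  constructor
  · rintro ⟨hxt, hxK⟩
    exact ⟨⟨x⁻¹, ⟨hxt, x, hxK, rfl⟩, inv_inv x⟩, hxK⟩
  · rintro ⟨⟨y, ⟨hyt, -⟩, rfl⟩, hxK⟩
    exact ⟨by simpa using hyt, hxK⟩

theorem continuous_inv_of_isCompact_image_inv [T2Space G] [FirstCountableTopology G]
    (hk : ∀ F : Set G, IsCompact F → IsCompact ((fun x : G => x⁻¹) '' F)) :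
    Continuous (fun x : G => x⁻¹) := by
  refine SeqContinuous.continuous fun x a hx => ?_
  have hc := continuousOn_inv_of_isCompact_image_inv hk hx.isCompact_insert_range
  exact (hc a (mem_insert a _)).tendsto.comp (tendsto_nhdsWithin_iff.2
    ⟨hx, Eventually.of_forall fun n => mem_insert_of_mem a (mem_range_self n)⟩)

theorem metrizableSpace_of_firstCountable_group [IsTopologicalGroup G] [T0Space G]
    [FirstCountableTopology G] : TopologicalSpace.MetrizableSpace G := by
  let := IsTopologicalGroup.rightUniformSpace G
  have : (uniformity G).IsCountablyGenerated :=
    Filter.comap.isCountablyGenerated (𝓝 (1 : G)) fun p : G × G => p.2 * p.1⁻¹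
  exact UniformSpace.metrizableSpace

/-- A countable set closed under a countable-valued operation on finite sets. -/
theorem exists_countable_closed_finset {ι : Type*} (e : Finset ι → Set ι)
    (he : ∀ s, (e s).Countable) :
    ∃ N : Set ι, N.Countable ∧ ∀ s : Finset ι, (s : Set ι) ⊆ N → e s ⊆ N := by
  classical
  let step : Set ι → Set ι := fun A => A ∪ ⋃ s ∈ {s : Finset ι | (s : Set ι) ⊆ A}, e s
  let N : ℕ → Set ι := fun k => step^[k] ∅
  have hN : ∀ k, N (k + 1) = step (N k) := fun k => Function.iterate_succ_apply' step k ∅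
  have hmono : Monotone N := monotone_nat_of_le_succ fun k => by
    rw [hN]
    exact subset_union_left
  refine ⟨⋃ k, N k, countable_iUnion fun k => ?_, fun s hs => ?_⟩
  · induction k with
    | zero => exact countable_empty
    | succ k ih =>
      rw [hN]
      refine ih.union (Countable.biUnion ?_ fun s _ => he s)
      refine ((countable_ofPred_finite_subset ih).preimage
        Finset.coe_injective).mono fun s hs => ?_
      exact ⟨s.finite_toSet, hs⟩
  · obtain ⟨k, hk⟩ := hmono.directed_le.exists_mem_subset_of_finset_subset_biUnion hs
    refine Subset.trans ?_ (subset_iUnion N (k + 1))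
    rw [hN]
    exact Subset.trans (subset_biUnion_of_mem (u := e) (show s ∈ {s : Finset ι | (s : Set ι) ⊆ N k}
      from hk)) subset_union_right

variable [ContinuousMul G]

theorem exists_finite_closed_cover_mul_inv_mul_mem [T3Space G] {K U : Set G} (hK : IsCompact K)
    (hinv : ContinuousOn (fun x : G => x⁻¹) K) (hU : IsOpen U) {x : G} (hx : x ∈ U) :
    ∃ T : Set (Set G), T.Finite ∧ K ⊆ ⋃₀ T ∧
      ∀ C ∈ T, IsClosed C ∧ ∀ y ∈ C ∩ K, ∀ z ∈ C ∩ K, y * z⁻¹ * x ∈ U := by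
  have hloc : ∀ a ∈ K, ∃ C ∈ 𝓝 a, IsClosed C ∧ ∀ y ∈ C ∩ K, ∀ z ∈ C ∩ K, y * z⁻¹ * x ∈ U := by
    intro a ha
    have hcont : ContinuousOn (fun p : G × G => p.1 * p.2⁻¹ * x) (K ×ˢ K) :=
      (continuousOn_fst.mul (hinv.comp continuousOn_snd fun p hp => hp.2)).mul continuousOn_const
    have hmem := hcont (a, a) ⟨ha, ha⟩ (hU.mem_nhds (by simpa using hx))
    rw [nhdsWithin_prod_eq, Filter.mem_map, mem_prod_same_iff] at hmem
    obtain ⟨t, ht, htU⟩ := hmem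
    obtain ⟨u, hu, hut⟩ := mem_nhdsWithin_iff_exists_mem_nhds_inter.1 ht
    obtain ⟨C, hC, hCc, hCu⟩ := exists_mem_nhds_isClosed_subset hu
    exact ⟨C, hC, hCc, fun y hy z hz => htU (show (y, z) ∈ t ×ˢ t from
      ⟨hut ⟨hCu hy.1, hy.2⟩, hut ⟨hCu hz.1, hz.2⟩⟩)⟩
  choose! C hC hC' using hloc
  obtain ⟨t, htK, ht⟩ := hK.elim_nhds_subcover C hC
  refine ⟨C '' t, t.finite_toSet.image C, by simpa using ht, ?_⟩
  rintro _ ⟨a, ha, rfl⟩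
  exact hC' a (htK a ha)

/-- A disjoint family of open sets meeting a fixed compact set, on which inversion is continuous,
is countable. -/
theorem countable_of_pairwise_disjoint_of_mem_isCompact [T3Space G] {K : Set G}
    (hK : IsCompact K) (hinv : ContinuousOn (fun x : G => x⁻¹) K) {ι : Type*} {x : ι → G}
    {U : ι → Set G} (hxK : ∀ i, x i ∈ K) (hxU : ∀ i, x i ∈ U i) (hU : ∀ i, IsOpen (U i))
    (hdis : Pairwise fun i j => Disjoint (U i) (U j)) : Countable ι := by
  choose T hTfin hTK hT using fun i =>
    exists_finite_closed_cover_mul_inv_mul_mem hK hinv (hU i) (hxU i)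
  choose a haT hxa using fun i j => mem_sUnion.1 (hTK i (hxK j))
  have hrep : ∀ s : Finset ι, ∃ e : Set ι, e.Countable ∧ ∀ j, ∃ k ∈ e, ∀ i ∈ s, a i k = a i j := by
    intro s
    let address : ι → s → Set G := fun j i => a i j
    have hfin : (range address).Finite :=
      (Set.Finite.pi' fun i : s => hTfin i).subset (range_subset_iff.2 fun j i => haT i j)
    have := hfin.countable.to_subtype
    refine ⟨range (rangeSplitting address), countable_range _, fun j =>
      ⟨_, mem_range_self ⟨address j, mem_range_self j⟩, fun i hi => ?_⟩⟩
    exact congrFun (apply_rangeSplitting address ⟨address j, mem_range_self j⟩) ⟨i, hi⟩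
  choose e he hej using hrep
  obtain ⟨N, hN, hclosed⟩ := exists_countable_closed_finset e he
  suffices hall : ∀ j, j ∈ N from
    countable_univ_iff.1 (hN.mono fun j _ => hall j)
  intro j
  classical
  let A : Finset N → Set G := fun s => closure (x '' {k ∈ N | ∀ i ∈ s, a i k = a i j})
  have hAK : ∀ s, A s ⊆ K := fun s =>
    closure_minimal (image_subset_iff.2 fun k _ => hxK k) hK.isClosed
  have hAne : ∀ s, (A s).Nonempty := by
    intro s
    obtain ⟨k, hk, hkj⟩ := hej (s.map (Function.Embedding.subtype _)) j
    refine ⟨x k, subset_closure ⟨k, ⟨hclosed _ ?_ hk, fun i hi => hkj i ?_⟩, rfl⟩⟩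
    · simp
    · simpa using hi
  have hAdir : Directed (· ⊇ ·) A := directed_of_isDirected_le fun s t hst =>
    closure_mono (image_mono fun k hk => ⟨hk.1, fun i hi => hk.2 i (Finset.mem_of_subset hst hi)⟩)
  obtain ⟨p, hp⟩ := IsCompact.nonempty_iInter_of_directed_nonempty_isCompact_isClosed A hAdir hAne
    (fun s => hK.of_isClosed_subset isClosed_closure (hAK s)) fun s => isClosed_closure
  rw [mem_iInter] at hp
  have hpa : ∀ i : N, p ∈ a i j := by
    intro i
    refine closure_minimal ?_ (hT i _ (haT i j)).1 (hp {i})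
    rintro _ ⟨k, ⟨-, hk⟩, rfl⟩
    rw [← hk i (Finset.mem_singleton_self i)]
    exact hxa i k
  have hopen : IsOpen ((fun z => x j * p⁻¹ * z) ⁻¹' U j) :=
    (hU j).preimage (continuous_const_mul _)
  obtain ⟨_, hkU, k, ⟨hkN, -⟩, rfl⟩ := mem_closure_iff.1 (hp ∅) _ hopen (by simpa using hxU j)
  have hkU' : x j * p⁻¹ * x k ∈ U k :=
    (hT k _ (haT k j)).2 _ ⟨hxa k j, hxK j⟩ _ ⟨hpa ⟨k, hkN⟩, hAK _ (hp ∅)⟩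
  by_contra hj
  exact disjoint_left.1 (hdis fun h : j = k => hj (h ▸ hkN)) hkU hkU'

/-- A point with a countable local π-base in a Hausdorff paratopological group is a Gδ. -/
theorem isGδ_singleton_of_countable_local_piBase [T2Space G] {g : G} {P : Set (Set G)}
    (hP : P.Countable) (hPo : ∀ E ∈ P, IsOpen E ∧ E.Nonempty)
    (hPg : ∀ V, IsOpen V → g ∈ V → ∃ E ∈ P, E ⊆ V) : IsGδ ({g} : Set G) := by
  choose! hPo p hp using hPo
  have heq : ({g} : Set G) = ⋂ E ∈ P, (fun z => p E * g⁻¹ * z) ⁻¹' E := by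
    refine Subset.antisymm (singleton_subset_iff.2 (mem_iInter₂.2 fun E hE => ?_)) fun z hz => ?_
    · simpa using hp E hE
    by_contra hzg
    obtain ⟨u, v, hu, hv, hgu, hzv, huv⟩ := t2_separation (Ne.symm hzg)
    obtain ⟨E, hE, hEV⟩ := hPg (u ∩ (fun w => w * (g⁻¹ * z)) ⁻¹' v)
      (hu.inter (hv.preimage (continuous_mul_const _))) ⟨hgu, by simpa using hzv⟩
    have h1 : p E * (g⁻¹ * z) ∈ v := (hEV (hp E hE)).2
    have h2 : p E * g⁻¹ * z ∈ u := (hEV (mem_iInter₂.1 hz E hE)).1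
    rw [mul_assoc] at h2
    exact disjoint_left.1 huv h2 h1
  rw [heq]
  exact .biInter_of_isOpen hP fun E hE => (hPo E hE).preimage (continuous_const_mul _)

theorem firstCountableTopology_of_isCountablyGenerated_nhds {g : G}
    (hg : (𝓝 g).IsCountablyGenerated) : FirstCountableTopology G := by
  refine ⟨fun h => ?_⟩
  have := (Homeomorph.mulLeft (h * g⁻¹)).map_nhds_eq g
  simp only [Homeomorph.coe_mulLeft, inv_mul_cancel_right] at this
  rw [← this]
  infer_instance

theorem locallyCompactSpace_of_mem_nhds [T2Space G] {g : G} {C : Set G} (hC : IsCompact C)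
    (hg : C ∈ 𝓝 g) : LocallyCompactSpace G := by
  have : WeaklyLocallyCompactSpace G := ⟨fun h => by
    refine ⟨_, hC.image (continuous_const_mul (h * g⁻¹)), ?_⟩
    have := (Homeomorph.mulLeft (h * g⁻¹)).map_nhds_eq g
    simp only [Homeomorph.coe_mulLeft, inv_mul_cancel_right] at this
    rw [← this]
    exact image_mem_map hg⟩
  infer_instance

end ParatopologicalGroup

section Remainder

variable {G X : Type*} [Group G] [TopologicalSpace G] [ContinuousMul G]
  [TopologicalSpace X] {f : G → X}

/-- Disjoint families of open sets are countable in every compactification of a σ-compact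
paratopological group on whose compact subsets inversion is continuous. -/
theorem countable_of_pairwiseDisjoint_of_iUnion_compact [T3Space G] (hf : IsEmbedding f)
    (hd : DenseRange f)
    (hinv : ∀ K : Set G, IsCompact K → ContinuousOn (fun x : G => x⁻¹) K) {K : ℕ → Set G}
    (hK : ∀ n, IsCompact (K n)) (hcov : ∀ g, ∃ n, g ∈ K n) {V : Set (Set X)}
    (hV : ∀ v ∈ V, IsOpen v ∧ v.Nonempty) (hdis : V.PairwiseDisjoint id) : V.Countable := by
  choose x hx using fun v : V => hd.exists_mem_open (hV v v.2).1 (hV v v.2).2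
  have hn : ∀ n, {v : V | x v ∈ K n}.Countable := by
    intro n
    refine countable_coe_iff.1 (countable_of_pairwise_disjoint_of_mem_isCompact (hK n) (hinv _ (hK n))
      (x := fun v : {v : V | x v ∈ K n} => x v) (U := fun v => f ⁻¹' (v.1 : Set X))
      (fun v => v.2) (fun v => hx v) (fun v => (hV v.1 v.1.2).1.preimage hf.continuous) ?_)
    intro v w hvw
    refine Disjoint.preimage f (hdis v.1.2 w.1.2 fun h => hvw ?_)
    exact Subtype.ext (Subtype.ext h)
  have huniv : (univ : Set V) ⊆ ⋃ n, {v : V | x v ∈ K n} := fun v _ => mem_iUnion.2 (hcov (x v))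
  exact countable_coe_iff.1 (countable_univ_iff.1 ((countable_iUnion hn).mono huniv))

variable [CompactSpace X] [T2Space X]

theorem dense_compl_range_of_not_locallyCompactSpace (hf : IsEmbedding f)
    (hnlc : ¬ LocallyCompactSpace G) : Dense (range f)ᶜ := by
  have : T2Space G := hf.t2Space
  rw [dense_iff_inter_open]
  rintro O hO ⟨x, hx⟩
  by_contra hne
  have hsub : O ⊆ range f := fun z hz => by_contra fun h => hne ⟨z, hz, h⟩
  obtain ⟨g, rfl⟩ := hsub hx
  obtain ⟨C, hC, hCc, hCO⟩ := exists_mem_nhds_isClosed_subset (hO.mem_nhds hx)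
  exact hnlc (locallyCompactSpace_of_mem_nhds
    (hf.isInducing.isCompact_preimage' hCc.isCompact (hCO.trans hsub))
    (hf.continuous.continuousAt hC))

theorem firstCountableTopology_of_isClosed_isGδ (hf : IsEmbedding f) (hd : DenseRange f)
    (hY : Dense (range f)ᶜ)
    (hbase : ∀ y ∈ (range f)ᶜ, ∃ W : Set (Set X), W.Countable ∧ (∀ w ∈ W, IsOpen w ∧ {y} ⊆ w) ∧
      ∀ O, IsOpen O → {y} ⊆ O → ∃ w ∈ W, w ⊆ O)
    {F : Set X} (hF : IsClosed F) (hFG : IsGδ F) (hFne : F.Nonempty) (hFf : F ⊆ range f) :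
    FirstCountableTopology G := by
  have : T2Space G := hf.t2Space
  obtain ⟨R, hRanti, hRo, hFR, hRb⟩ := exists_antitone_open_outer_base hF hFG
  choose y hyR hyY using fun n => hY.inter_open_nonempty (R n) (hRo n) (hFne.mono (hFR n))
  obtain ⟨h, hh⟩ := exists_clusterPt_of_compactSpace (map y atTop)
  have hfreq : ∀ O, IsOpen O → h ∈ O → ∃ᶠ n in atTop, y n ∈ O := fun O hO hhO =>
    MapClusterPt.frequently hh (hO.mem_nhds hhO)
  have hhF : h ∈ F := by
    by_contra hhF
    obtain ⟨u, v, hu, hv, hFu, hhv, huv⟩ := SeparatedNhds.of_isCompact_isCompact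
      hF.isCompact (isCompact_singleton (x := h)) (by simpa using hhF)
    obtain ⟨n, hn⟩ := hRb u hu hFu
    obtain ⟨m, hm, hym⟩ := (frequently_atTop.1 (hfreq v hv (hhv rfl))) n
    exact disjoint_left.1 huv (hn (hRanti hm (hyR m))) hym
  obtain ⟨g, rfl⟩ := hFf hhF
  choose W hWc hWo hWb using fun n => hbase (y n) (hyY n)
  have hg : IsGδ ({g} : Set G) := by
    refine isGδ_singleton_of_countable_local_piBase
      (P := (fun w => f ⁻¹' w) '' ⋃ n, W n) ((countable_iUnion hWc).image _) ?_ ?_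
    · rintro _ ⟨w, hw, rfl⟩
      obtain ⟨n, hn⟩ := mem_iUnion.1 hw
      have hwo := hWo n w hn
      obtain ⟨a, ha⟩ := hd.exists_mem_open hwo.1 ⟨y n, hwo.2 rfl⟩
      exact ⟨hwo.1.preimage hf.continuous, a, ha⟩
    · intro V hV hgV
      obtain ⟨O, hO, rfl⟩ := hf.isInducing.isOpen_iff.1 hV
      obtain ⟨n, hn⟩ := (hfreq O hO hgV).exists
      obtain ⟨w, hw, hwO⟩ := hWb n O hO (singleton_subset_iff.2 hn)
      exact ⟨_, mem_image_of_mem _ (mem_iUnion.2 ⟨n, hw⟩), preimage_mono hwO⟩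
  obtain ⟨Q, hQ, hQeq⟩ := hg.eq_iInter_nat
  choose Q' hQ' hQQ' using fun n => hf.isInducing.isOpen_iff.1 (hQ n)
  have hfg : IsGδ ({f g} : Set X) := by
    have heq : ({f g} : Set X) = F ∩ ⋂ n, Q' n := by
      refine Subset.antisymm (singleton_subset_iff.2 ⟨hhF, mem_iInter.2 fun n => ?_⟩) ?_
      · have : g ∈ Q n := mem_iInter.1 (hQeq ▸ mem_singleton g) n
        rwa [← hQQ' n] at this
      · rintro z ⟨hzF, hz⟩
        obtain ⟨a, rfl⟩ := hFf hzF
        have ha : a ∈ ({g} : Set G) := by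
          rw [hQeq]
          refine mem_iInter.2 fun n => ?_
          rw [← hQQ' n]
          exact mem_iInter.1 hz n
        exact congrArg f ha
    rw [heq]
    exact hFG.inter (.iInter_of_isOpen hQ')
  obtain ⟨R', -, hRo', hgR', hRb'⟩ := exists_antitone_open_outer_base isClosed_singleton hfg
  have hbasis : (𝓝 (f g)).HasBasis (fun _ : ℕ => True) R' := by
    refine hasBasis_iff.2 fun t => ⟨fun ht => ?_, ?_⟩
    · obtain ⟨O, hOt, hO, hgO⟩ := mem_nhds_iff.1 ht
      obtain ⟨n, hn⟩ := hRb' O hO (singleton_subset_iff.2 hgO)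
      exact ⟨n, trivial, hn.trans hOt⟩
    · rintro ⟨n, -, hn⟩
      exact mem_of_superset ((hRo' n).mem_nhds (hgR' n rfl)) hn
  have := HasCountableBasis.isCountablyGenerated ⟨hbasis, to_countable _⟩
  refine firstCountableTopology_of_isCountablyGenerated_nhds (g := g) ?_
  rw [hf.isInducing.nhds_eq_comap]
  infer_instance

/-- Under the stated hypotheses, the group contains a nonempty closed Gδ-set of its
compactification. -/
theorem exists_isClosed_isGδ_subset_range [T3Space G] (hf : IsEmbedding f) (hd : DenseRange f)
    (hY : Dense (range f)ᶜ)
    (hinv : ∀ K : Set G, IsCompact K → ContinuousOn (fun x : G => x⁻¹) K)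
    {B : Set (Set ((range f)ᶜ : Set X))} (hB : TopologicalSpace.IsTopologicalBasis B)
    (hpc : ∀ y, {b ∈ B | y ∈ b}.Countable) {S : ℕ → Set (Set X)}
    (hS : IsDiagonalSequence (range f)ᶜ S) :
    ∃ F : Set X, IsClosed F ∧ IsGδ F ∧ F.Nonempty ∧ F ⊆ range f := by
  by_contra! hcon
  have hmeet : ∀ C : Set X, IsClosed C → IsGδ C → C.Nonempty → (C ∩ (range f)ᶜ).Nonempty :=
    fun C hC hCG hne => inter_compl_nonempty_iff.2 (hcon C hC hCG hne)
  have hout : ∀ x ∉ (range f)ᶜ, ∃ n, ∀ U ∈ S n, x ∉ U := fun x hx =>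
    hS.exists_forall_notMem hmeet hx
  let K : ℕ → Set G := fun n => f ⁻¹' (⋃₀ S n)ᶜ
  have hK : ∀ n, IsCompact (K n) := fun n => hf.isInducing.isCompact_preimage'
    (isOpen_sUnion (hS.isOpen n)).isClosed_compl.isCompact (compl_subset_comm.1 fun y hy =>
      mem_sUnion.2 (hS.covers n y hy))
  have hcov : ∀ g, ∃ n, g ∈ K n := by
    intro g
    obtain ⟨n, hn⟩ := hout (f g) (by simp)
    exact ⟨n, fun ⟨U, hU, hgU⟩ => hn U hU hgU⟩
  obtain ⟨P, hP⟩ := hS.exists_isCountablePiBase hY hout fun V hV hdis =>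
    countable_of_pairwiseDisjoint_of_iUnion_compact hf hd hinv hK hcov hV hdis
  have := hP.secondCountableTopology hY hB hpc
  obtain ⟨C, hC, hCG, hmem, hdis⟩ := exists_isClosed_isGδ_disjoint
    (show f 1 ∉ (range f)ᶜ by simp)
  obtain ⟨z, hzC, hzY⟩ := hmeet C hC hCG ⟨_, hmem⟩
  exact disjoint_left.1 hdis hzC hzY

end Remainder

/-- Suppose `G` is a non-locally compact, k-gentle Tychonoff paratopological
group (inversion maps compact sets to compact sets), and `Y = bG \ G` is the
remainder of `G` in a Hausdorff compactification `bG` of `G` (here `G` is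
embedded densely into the compact Hausdorff space `bG` via `f`). If `Y` has a
point-countable base and a Gδ-diagonal, then `G`, `bG` and `Y` are separable
and metrizable spaces. -/
theorem remainder_pointCountable_base_gdelta_diagonal {G bG : Type*}
    [Group G] [TopologicalSpace G] [ContinuousMul G] [T35Space G]
    [TopologicalSpace bG] [CompactSpace bG] [T2Space bG]
    (f : G → bG) (hf : Topology.IsEmbedding f) (hd : DenseRange f)
    (hnlc : ¬ LocallyCompactSpace G)
    (hk : ∀ F : Set G, IsCompact F → IsCompact ((fun x : G => x⁻¹) '' F))
    (hbase : ∃ B : Set (Set ((Set.range f)ᶜ : Set bG)),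
      TopologicalSpace.IsTopologicalBasis B ∧
      ∀ y : ((Set.range f)ᶜ : Set bG), {b ∈ B | y ∈ b}.Countable)
    (hdiag : IsGδ (Set.diagonal ((Set.range f)ᶜ : Set bG))) :
    TopologicalSpace.SeparableSpace G ∧ TopologicalSpace.MetrizableSpace G ∧
    TopologicalSpace.SeparableSpace bG ∧ TopologicalSpace.MetrizableSpace bG ∧
    TopologicalSpace.SeparableSpace ((Set.range f)ᶜ : Set bG) ∧
    TopologicalSpace.MetrizableSpace ((Set.range f)ᶜ : Set bG) := by
  obtain ⟨B, hB, hpc⟩ := hbase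
  obtain ⟨S, hS⟩ := exists_isDiagonalSequence hdiag
  have hY : Dense (range f)ᶜ := dense_compl_range_of_not_locallyCompactSpace hf hnlc
  obtain ⟨F, hF, hFG, hFne, hFf⟩ := exists_isClosed_isGδ_subset_range hf hd hY
    (fun K hK => continuousOn_inv_of_isCompact_image_inv hk hK) hB hpc hS
  have : FirstCountableTopology G := firstCountableTopology_of_isClosed_isGδ hf hd hY
    (fun y hy => exists_countable_outer_base hY hB hpc isCompact_singleton
      (singleton_subset_iff.2 hy) (countable_singleton y) Subset.rfl subset_closure)
    hF hFG hFne hFf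
  have : IsTopologicalGroup G :=
    { continuous_inv := continuous_inv_of_isCompact_image_inv hk }
  have : TopologicalSpace.MetrizableSpace G := metrizableSpace_of_firstCountable_group
  have hL : IsLindelof (range f) := by
    simpa using isLindelof_compl_of_pointCountable hY hB hpc hS
  have : LindelofSpace G := ⟨by rwa [hf.isLindelof_iff, image_univ]⟩
  have : SecondCountableTopology G := inferInstance
  obtain ⟨P, hP⟩ := exists_isCountablePiBase_of_denseRange hf.isInducing hd
  have : SecondCountableTopology ((range f)ᶜ : Set bG) := hP.secondCountableTopology hY hB hpc
  have : TopologicalSpace.MetrizableSpace bG := metrizableSpace_of_secondCountable hf.continuous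
  exact ⟨inferInstance, inferInstance, hd.separableSpace hf.continuous, inferInstance,
    inferInstance, inferInstance⟩
end

section
/- Suppose that G is a non-locally compact, k-gentle Tychonoff paratopological group, and Y = bG \ G is the remainder of G in some Hausdorff compactification bG of G. Then the following conditions are equivalent: (1) Y is of subcountable type; (2) Y is of countable type. -/
open Filter Topology Set

/-- A space `X` is of countable type if every compact subspace `F` of `X` is
contained in a compact subspace `K ⊆ X` that has a countable base of open
neighborhoods in `X`. -/
def CountableType (X : Type*) [TopologicalSpace X] : Prop :=
  ∀ F : Set X, IsCompact F → ∃ K : Set X, IsCompact K ∧ F ⊆ K ∧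
    ∃ B : ℕ → Set X, (∀ n, IsOpen (B n) ∧ K ⊆ B n) ∧
      ∀ V : Set X, IsOpen V → K ⊆ V → ∃ n, B n ⊆ V

/-- A space `X` is of subcountable type if every compact subspace of `X` is
contained in a compact subspace of `X` which is a Gδ-set in `X`. -/
def SubcountableType (X : Type*) [TopologicalSpace X] : Prop :=
  ∀ F : Set X, IsCompact F → ∃ K : Set X, IsCompact K ∧ F ⊆ K ∧ IsGδ K

/-- In a normal space, any sequence of open neighborhoods of a closed set can be refined to a
sequence of open neighborhoods each containing the closure of the next one. -/
theorem exists_nested_open_nhds {X : Type*} [TopologicalSpace X] [NormalSpace X] {K : Set X}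
    (hK : IsClosed K) (U : ℕ → Set X) (hU : ∀ n, IsOpen (U n)) (hKU : ∀ n, K ⊆ U n) :
    ∃ V : ℕ → Set X, (∀ n, IsOpen (V n)) ∧ (∀ n, K ⊆ V n) ∧ (∀ n, V n ⊆ U n) ∧
      ∀ n, closure (V (n + 1)) ⊆ V n := by
  have step : ∀ (n : ℕ) (s : {s : Set X // IsOpen s ∧ K ⊆ s}),
      ∃ t : {s : Set X // IsOpen s ∧ K ⊆ s}, closure t.1 ⊆ s.1 ∩ U (n + 1) := by
    rintro n ⟨s, hs, hKs⟩
    obtain ⟨t, ht, hKt, hts⟩ := normal_exists_closure_subset hK (hs.inter (hU (n + 1)))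
      (subset_inter hKs (hKU (n + 1)))
    exact ⟨⟨t, ht, hKt⟩, hts⟩
  choose next hnext using step
  let V : ℕ → {s : Set X // IsOpen s ∧ K ⊆ s} :=
    fun n => Nat.rec ⟨U 0, hU 0, hKU 0⟩ next n
  have hV : ∀ n, closure (V (n + 1)).1 ⊆ (V n).1 ∩ U (n + 1) := fun n => hnext n (V n)
  refine ⟨fun n => (V n).1, fun n => (V n).2.1, fun n => (V n).2.2, fun n => ?_,
    fun n => (hV n).trans inter_subset_left⟩
  cases n with
  | zero => exact subset_rfl
  | succ n => exact subset_closure.trans ((hV n).trans inter_subset_right)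

theorem antitone_of_closure_succ_subset {X : Type*} [TopologicalSpace X] {V : ℕ → Set X}
    (hV : ∀ n, closure (V (n + 1)) ⊆ V n) : Antitone V :=
  antitone_nat_of_succ_le fun n => subset_closure.trans (hV n)

theorem isClosed_iInter_of_closure_succ_subset {X : Type*} [TopologicalSpace X] {V : ℕ → Set X}
    (hV : ∀ n, closure (V (n + 1)) ⊆ V n) : IsClosed (⋂ n, V n) := by
  have : ⋂ n, V n = ⋂ n, closure (V n) := by
    refine subset_antisymm (iInter_mono fun n => subset_closure) ?_
    exact subset_iInter fun n => (iInter_subset _ (n + 1)).trans (hV n)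
  rw [this]
  exact isClosed_iInter fun n => isClosed_closure

/-- In a compact space, a nested sequence of open sets is a neighborhood base of its
intersection. -/
theorem exists_subset_of_iInter_subset {X : Type*} [TopologicalSpace X] [CompactSpace X]
    {V : ℕ → Set X} (hV : ∀ n, closure (V (n + 1)) ⊆ V n) {O : Set X} (hO : IsOpen O)
    (h : ⋂ n, V n ⊆ O) : ∃ n, V n ⊆ O := by
  have hanti := antitone_of_closure_succ_subset hV
  obtain ⟨n, hn⟩ := exists_subset_nhds_of_compactSpace (V := fun n => closure (V n))
    (Antitone.directed_ge fun m n hmn => closure_mono (hanti hmn)) (fun n => isClosed_closure)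
    (U := O) fun x hx => hO.mem_nhds <| h <| mem_iInter.2 fun n => hV n (mem_iInter.1 hx (n + 1))
  exact ⟨n, subset_closure.trans hn⟩

/-- In a T₁ space, a set with a countable base of open neighborhoods is a Gδ set. -/
theorem CountableType.subcountableType {X : Type*} [TopologicalSpace X] [T1Space X]
    (h : CountableType X) : SubcountableType X := by
  intro F hF
  obtain ⟨K, hK, hFK, B, hB, hbase⟩ := h F hF
  refine ⟨K, hK, hFK, ?_⟩
  have : K = ⋂ n, B n := by
    refine subset_antisymm (subset_iInter fun n => (hB n).2) fun y hy => ?_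
    by_contra hyK
    obtain ⟨n, hn⟩ := hbase {y}ᶜ isOpen_compl_singleton
      (subset_compl_singleton_iff.2 hyK)
    exact hn (mem_iInter.1 hy n) rfl
  rw [this]
  exact IsGδ.iInter_of_isOpen fun n => (hB n).1

/-- A compact subset of a subspace `s` of subcountable type extends to a compact `K ⊆ s`, which is
the trace on `s` of the intersection of a nested sequence of open sets of the ambient space. -/
theorem SubcountableType.exists_nested {X : Type*} [TopologicalSpace X] [CompactSpace X] [T2Space X]
    {s : Set X} (h : SubcountableType s) {F : Set X} (hF : IsClosed F) (hFs : F ⊆ s) :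
    ∃ (K : Set X) (V : ℕ → Set X), IsClosed K ∧ F ⊆ K ∧ K ⊆ s ∧ (∀ n, IsOpen (V n)) ∧
      (∀ n, K ⊆ V n) ∧ (∀ n, closure (V (n + 1)) ⊆ V n) ∧ (⋂ n, V n) \ K ⊆ sᶜ := by
  obtain ⟨K, hK, hFK, hG⟩ := h (Subtype.val ⁻¹' F)
    (IsInducing.subtypeVal.isCompact_preimage' hF.isCompact (by simpa using hFs))
  obtain ⟨U, hU, rfl⟩ := isGδ_iff_eq_iInter_nat.1 hG
  choose U' hU' hUU' using fun n => isOpen_induced_iff.1 (hU n)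
  have hKc : IsClosed (Subtype.val '' (⋂ n, U n) : Set X) :=
    (hK.image continuous_subtype_val).isClosed
  obtain ⟨V, hVo, hKV, hVU, hV⟩ := exists_nested_open_nhds hKc U' hU' (by
    rintro n _ ⟨y, hy, rfl⟩
    have := mem_iInter.1 hy n
    rwa [← hUU' n] at this)
  refine ⟨_, V, hKc, fun x hx => ⟨⟨x, hFs hx⟩, hFK hx, rfl⟩, ?_, hVo, hKV, hV, ?_⟩
  · rintro _ ⟨y, -, rfl⟩
    exact y.2
  · rintro x ⟨hx, hxK⟩ hxs
    refine hxK ⟨⟨x, hxs⟩, mem_iInter.2 fun n => ?_, rfl⟩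
    rw [← hUU' n]
    exact hVU n (mem_iInter.1 hx n)

/-- A subspace `s` of a compact Hausdorff space is of countable type if each compact subset of `s`
is contained in the intersection, itself within `s`, of a nested sequence of open sets. -/
theorem countableType_of_exists_nested {X : Type*} [TopologicalSpace X] [CompactSpace X]
    [T2Space X] {s : Set X}
    (h : ∀ F : Set X, IsClosed F → F ⊆ s → ∃ V : ℕ → Set X, (∀ n, IsOpen (V n)) ∧ (∀ n, F ⊆ V n) ∧
      (∀ n, closure (V (n + 1)) ⊆ V n) ∧ ⋂ n, V n ⊆ s) : CountableType s := by
  intro F hF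
  obtain ⟨V, hVo, hFV, hV, hVs⟩ := h (Subtype.val '' F)
    (hF.image continuous_subtype_val).isClosed (by rintro _ ⟨y, -, rfl⟩; exact y.2)
  refine ⟨Subtype.val ⁻¹' (⋂ n, V n), ?_, ?_, fun n => Subtype.val ⁻¹' V n, fun n => ⟨?_, ?_⟩, ?_⟩
  · exact IsInducing.subtypeVal.isCompact_preimage'
      (isClosed_iInter_of_closure_succ_subset hV).isCompact (by simpa using hVs)
  · exact fun y hy => mem_iInter.2 fun n => hFV n ⟨y, hy, rfl⟩
  · exact (hVo n).preimage continuous_subtype_val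
  · exact preimage_mono (iInter_subset _ n)
  · intro O hO hVO
    obtain ⟨O', hO', rfl⟩ := isOpen_induced_iff.1 hO
    obtain ⟨n, hn⟩ := exists_subset_of_iInter_subset hV hO'
      (fun x hx => hVO (a := ⟨x, hVs hx⟩) hx)
    exact ⟨n, preimage_mono hn⟩

/-- The complement of a Lindelöf subspace of a compact Hausdorff space is of countable type. -/
theorem countableType_compl_of_isLindelof {X : Type*} [TopologicalSpace X] [CompactSpace X]
    [T2Space X] {s : Set X} (hs : IsLindelof s) : CountableType (sᶜ : Set X) := by
  refine countableType_of_exists_nested fun F hF hFs => ?_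
  have key : ∀ x : s, ∃ U : Set X, IsOpen U ∧ x.1 ∈ U ∧ closure U ⊆ Fᶜ := fun x => by
    obtain ⟨U, hU, hxU, hUF⟩ := normal_exists_closure_subset (isClosed_singleton (x := x.1))
      hF.isOpen_compl (singleton_subset_iff.2 fun hxF => hFs hxF x.2)
    exact ⟨U, hU, hxU rfl, hUF⟩
  choose U hU hxU hUF using key
  rcases isEmpty_or_nonempty s with hemp | hne
  · exact ⟨fun _ => univ, fun _ => isOpen_univ, fun _ => subset_univ _, fun _ => subset_univ _,
      fun x _ hx => hemp.false ⟨x, hx⟩⟩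
  obtain ⟨t, ht⟩ := hs.indexed_countable_subcover U hU
    (fun x hx => mem_iUnion.2 ⟨⟨x, hx⟩, hxU _⟩)
  obtain ⟨V, hVo, hFV, hVU, hV⟩ := exists_nested_open_nhds hF (fun n => (closure (U (t n)))ᶜ)
    (fun n => isClosed_closure.isOpen_compl) (fun n => subset_compl_comm.1 (hUF (t n)))
  refine ⟨V, hVo, hFV, hV, fun x hx hxs => ?_⟩
  obtain ⟨n, hn⟩ := mem_iUnion.1 (ht hxs)
  exact hVU n (mem_iInter.1 hx n) (subset_closure hn)

/-- If the remainder of a nowhere locally compact space is of subcountable type, then every locally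
finite family of nonempty open sets is countable. -/
theorem SubcountableType.countable_of_locallyFinite {X bX : Type*} [TopologicalSpace X]
    [TopologicalSpace bX] [CompactSpace bX] [T2Space bX] {f : X → bX} (hf : IsEmbedding f)
    (h : SubcountableType ((range f)ᶜ : Set bX))
    (hnlc : ∀ K : Set X, IsCompact K → interior K = ∅) {ι : Type*} {U : ι → Set X}
    (hU : ∀ i, IsOpen (U i)) (hne : ∀ i, (U i).Nonempty) (hlf : LocallyFinite U) :
    Countable ι := by
  let A : Set bX := {z | ∀ N ∈ 𝓝 z, {i | (f '' U i ∩ N).Nonempty}.Infinite}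
  have hA : IsClosed A := by
    rw [← isOpen_compl_iff, isOpen_iff_mem_nhds]
    intro z hz
    simp only [A, mem_compl_iff, mem_ofPred_eq, not_forall, not_infinite] at hz
    obtain ⟨N, hN, hfin⟩ := hz
    filter_upwards [eventually_mem_nhds_iff.2 hN] with y hy hyA
    exact hyA N hy hfin
  have hAs : A ⊆ (range f)ᶜ := by
    rintro _ hz ⟨x, rfl⟩
    obtain ⟨N, hN, hfin⟩ := hlf x
    obtain ⟨M, hM, hMN⟩ := (hf.nhds_eq_comap x ▸ hN : N ∈ comap f (𝓝 (f x)))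
    refine hz M hM (hfin.subset ?_)
    rintro i ⟨_, ⟨y, hy, rfl⟩, hyM⟩
    exact ⟨y, hy, hMN hyM⟩
  obtain ⟨K, V, hK, hAK, hKs, hVo, hKV, hV, hVK⟩ := h.exists_nested hA hAs
  have hfin : ∀ n, {i | (f '' U i ∩ (V n)ᶜ).Nonempty}.Finite := by
    intro n
    refine (hVo n).isClosed_compl.isCompact.induction_on
      (p := fun S => {i | (f '' U i ∩ S).Nonempty}.Finite) ?_ ?_ ?_ ?_
    · simp
    · exact fun S T hST hT => hT.subset fun i hi => hi.mono (inter_subset_inter_right _ hST)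
    · intro S T hS hT
      refine (hS.union hT).subset fun i hi => ?_
      simpa only [mem_union, mem_ofPred_eq, inter_union_distrib_left, union_nonempty] using hi
    · intro z hz
      have hzA : z ∉ A := fun hzA => hz (hKV n (hAK hzA))
      simp only [A, mem_ofPred_eq, not_forall, not_infinite] at hzA
      obtain ⟨N, hN, hfin⟩ := hzA
      exact ⟨N, mem_nhdsWithin_of_mem_nhds hN, hfin⟩
  have hcov : ∀ i, ∃ n, (f '' U i ∩ (V n)ᶜ).Nonempty := by
    intro i
    by_contra! hi
    have hsub : ∀ y ∈ U i, f y ∈ ⋂ n, V n := fun y hy => mem_iInter.2 fun n => by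
      by_contra hyn
      exact (hi n).subset ⟨⟨y, hy, rfl⟩, hyn⟩
    obtain ⟨x, hx⟩ := hne i
    have hxK : f x ∉ K := fun hxK => hKs hxK ⟨x, rfl⟩
    obtain ⟨C, ⟨hC, hCc⟩, hCK⟩ := (closed_nhds_basis (f x)).mem_iff.1 (hK.isOpen_compl.mem_nhds hxK)
    have hcomp : IsCompact (f ⁻¹' (C ∩ ⋂ n, V n)) :=
      hf.isInducing.isCompact_preimage'
        (hCc.inter (isClosed_iInter_of_closure_succ_subset hV)).isCompact
        fun z hz => by simpa using hVK ⟨hz.2, hCK hz.1⟩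
    have hxint : x ∈ interior (f ⁻¹' (C ∩ ⋂ n, V n)) := by
      rw [mem_interior_iff_mem_nhds]
      filter_upwards [hf.continuous.continuousAt hC, (hU i).mem_nhds hx] with y hyC hyU
      exact ⟨hyC, hsub y hyU⟩
    rw [hnlc _ hcomp] at hxint
    exact hxint
  have : (univ : Set ι) ⊆ ⋃ n, {i | (f '' U i ∩ (V n)ᶜ).Nonempty} :=
    fun i _ => mem_iUnion.2 (hcov i)
  exact countable_univ_iff.1 ((countable_iUnion fun n => (hfin n).countable).mono this)

/-- A compact set `Q` with a countable decreasing base of neighborhoods `U`. -/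
structure IsCompactWithBase {X : Type*} [TopologicalSpace X] (Q : Set X) (U : ℕ → Set X) :
    Prop where
  isCompact : IsCompact Q
  isOpen (n : ℕ) : IsOpen (U n)
  subset (n : ℕ) : Q ⊆ U n
  antitone : Antitone U
  exists_subset {O : Set X} (hO : IsOpen O) (hQ : Q ⊆ O) : ∃ n, U n ⊆ O

/-- A set whose traces on compact sets are compact does not accumulate at a point outside it lying
in a compact set of countable character. -/
theorem IsCompactWithBase.compl_mem_nhds {X : Type*} [TopologicalSpace X] [T3Space X] {Q : Set X}
    {U : ℕ → Set X} (h : IsCompactWithBase Q U) {A : Set X}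
    (hA : ∀ C, IsCompact C → IsCompact (C ∩ A)) {x : X} (hxQ : x ∈ Q) (hxA : x ∉ A) :
    Aᶜ ∈ 𝓝 x := by
  by_contra hcon
  have hQA : IsClosed (Q ∩ A) := (hA Q h.isCompact).isClosed
  obtain ⟨N, ⟨hN, hNc⟩, hNQ⟩ := (closed_nhds_basis x).mem_iff.1
    (hQA.isOpen_compl.mem_nhds fun hx => hxA hx.2)
  have hpick : ∀ n, ∃ a, a ∈ A ∧ a ∈ N ∧ a ∈ U n := by
    intro n
    by_contra! hn
    refine hcon ?_
    filter_upwards [hN, (h.isOpen n).mem_nhds (h.subset n hxQ)] with y hyN hyU hyA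
    exact hn y hyA hyN hyU
  choose a haA haN haU using hpick
  have hC : IsCompact (Q ∪ range a) := by
    refine isCompact_of_finite_subcover fun {ι} O hO hcov => ?_
    obtain ⟨t, ht⟩ := h.isCompact.elim_finite_subcover O hO (subset_union_left.trans hcov)
    obtain ⟨n, hn⟩ := h.exists_subset (isOpen_biUnion fun i (_ : i ∈ t) => hO i) ht
    choose j hj using fun m => mem_iUnion.1 (hcov (Or.inr ⟨m, rfl⟩ : a m ∈ Q ∪ range a))
    classical
    refine ⟨t ∪ (Finset.range n).image j, ?_⟩
    rintro y (hy | ⟨m, rfl⟩)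
    · exact biUnion_subset_biUnion_left (fun i hi => Finset.mem_union_left _ hi) (ht hy)
    · rcases lt_or_ge m n with hmn | hmn
      · exact mem_biUnion (Finset.mem_union_right _
          (Finset.mem_image_of_mem j (Finset.mem_range.2 hmn))) (hj m)
      · exact biUnion_subset_biUnion_left (fun i hi => Finset.mem_union_left _ hi)
          (hn (h.antitone hmn (haU m)))
  have hD : IsClosed ((Q ∪ range a) ∩ A ∩ N) := (hA _ hC).isClosed.inter hNc
  obtain ⟨n, hn⟩ := h.exists_subset hD.isOpen_compl
    fun y hyQ hy => hNQ hy.2 ⟨hyQ, hy.1.2⟩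
  exact hn (haU n) ⟨⟨Or.inr ⟨n, rfl⟩, haA n⟩, haN n⟩

/-- A k-gentle paratopological group with a compact set of countable character around `1` has
continuous inversion. -/
theorem IsCompactWithBase.continuousInv {G : Type*} [Group G] [TopologicalSpace G]
    [ContinuousMul G] [T3Space G]
    (hk : ∀ F : Set G, IsCompact F → IsCompact ((fun x : G => x⁻¹) '' F))
    {Q : Set G} {U : ℕ → Set G} (h : IsCompactWithBase Q U) (h1 : (1 : G) ∈ Q) :
    ContinuousInv G := by
  have hone : Tendsto (fun x : G => x⁻¹) (𝓝 1) (𝓝 1) := by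
    refine (nhds_basis_opens (1 : G)).tendsto_right_iff.2 fun O ⟨h1O, hO⟩ => ?_
    have := h.compl_mem_nhds (A := {g | g⁻¹ ∉ O}) (fun C hC => ?_) h1 (by simpa using h1O)
    · filter_upwards [this] with x hx
      simpa using hx
    · convert hk _ ((hk C hC).diff hO) using 1
      ext g
      simp
  refine ⟨continuous_iff_continuousAt.2 fun x => ?_⟩
  have hx : Tendsto (fun y : G => x⁻¹ * y) (𝓝 x) (𝓝 1) := by
    simpa using (continuous_const_mul x⁻¹).tendsto x
  have := (hone.comp hx).mul_const x⁻¹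
  simpa [ContinuousAt, Function.comp_def] using this

open scoped Pointwise in
/-- In a topological group whose locally finite families of nonempty open sets are countable,
countably many translates of any neighborhood of `1` cover the group. -/
theorem exists_countable_translates_cover {G : Type*} [Group G] [TopologicalSpace G]
    [IsTopologicalGroup G]
    (hcc : ∀ (S : Set G) (U : S → Set G), (∀ i, IsOpen (U i)) → (∀ i, (U i).Nonempty) →
      LocallyFinite U → Countable S) {W : Set G} (hW : W ∈ 𝓝 (1 : G)) :
    ∃ S : Set G, S.Countable ∧ ∀ x, ∃ s ∈ S, s⁻¹ * x ∈ W := by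
  obtain ⟨N, hN, hNo, hN1, hNW⟩ : ∃ N : Set G, N⁻¹ = N ∧ IsOpen N ∧ (1 : G) ∈ N ∧
      ∀ a ∈ N, ∀ b ∈ N, ∀ c ∈ N, ∀ d ∈ N, a * b * c * d ∈ W ∩ W⁻¹ := by
    have hW' : W ∩ W⁻¹ ∈ 𝓝 (1 : G) := inter_mem hW (inv_mem_nhds_one G hW)
    obtain ⟨V, hV, hVW⟩ := exists_nhds_one_split4 hW'
    have h1 : (1 : G) ∈ interior V := mem_interior_iff_mem_nhds.2 hV
    refine ⟨interior V ∩ (interior V)⁻¹, by rw [inter_inv, inv_inv, inter_comm],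
      isOpen_interior.inter isOpen_interior.inv, ⟨h1, by simpa using h1⟩, ?_⟩
    exact fun a ha b hb c hc d hd => hVW (interior_subset ha.1) (interior_subset hb.1)
      (interior_subset hc.1) (interior_subset hd.1)
  obtain ⟨S, hS⟩ : ∃ S : Set G, Maximal
      (fun S : Set G => ∀ s ∈ S, ∀ t ∈ S, s⁻¹ * t ∈ W ∩ W⁻¹ → s = t) S := by
    refine zorn_subset _ fun c hc hchain => ⟨⋃₀ c, ?_, fun s hs => subset_sUnion_of_mem hs⟩
    rintro s ⟨S, hSc, hs⟩ t ⟨T, hTc, ht⟩ hst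
    rcases hchain.total hSc hTc with hST | hTS
    · exact hc hTc s (hST hs) t ht hst
    · exact hc hSc s hs t (hTS ht) hst
  refine ⟨S, ?_, fun x => ?_⟩
  · refine hcc S (fun s => (fun y => s.1⁻¹ * y) ⁻¹' N)
      (fun s => hNo.preimage (continuous_const_mul _)) (fun s => ⟨s, by simpa using hN1⟩) ?_
    intro g
    refine ⟨(fun y => g⁻¹ * y) ⁻¹' N, (hNo.preimage (continuous_const_mul _)).mem_nhds
      (by simpa using hN1), Set.Subsingleton.finite ?_⟩
    rintro s ⟨y, hys, hyg⟩ t ⟨z, hzt, hzg⟩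
    refine Subtype.ext (hS.prop s s.2 t t.2 ?_)
    have hinv : ∀ a ∈ N, a⁻¹ ∈ N := fun a ha => by rw [← hN]; simpa using ha
    convert hNW _ hys _ (hinv _ hyg) _ hzg _ (hinv _ hzt) using 1
    group
  · by_contra! hx
    have hx1 : (1 : G) ∈ W ∩ W⁻¹ := by simpa using mem_of_mem_nhds hW
    have hins : ∀ s ∈ insert x S, ∀ t ∈ insert x S, s⁻¹ * t ∈ W ∩ W⁻¹ → s = t := by
      rintro s (rfl | hs) t (rfl | ht) hst
      · rfl
      · exact absurd (by simpa using hst.2) (hx t ht)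
      · exact absurd hst.1 (hx s hs)
      · exact hS.prop s hs t ht hst
    have hxS : x ∈ S := hS.le_of_ge hins (subset_insert x S) (mem_insert x S)
    exact hx x hxS (by simpa using hx1.1)

/-- A topological group with a compact set of countable character around `1` is Lindelöf as soon as
its locally finite families of nonempty open sets are countable. -/
theorem IsCompactWithBase.lindelofSpace {G : Type*} [Group G] [TopologicalSpace G]
    [IsTopologicalGroup G] [T2Space G] {Q : Set G} {U : ℕ → Set G} (h : IsCompactWithBase Q U)
    (h1 : (1 : G) ∈ Q)
    (hcc : ∀ (S : Set G) (U : S → Set G), (∀ i, IsOpen (U i)) → (∀ i, (U i).Nonempty) →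
      LocallyFinite U → Countable S) : LindelofSpace G := by
  have step : ∀ (n : ℕ) (s : {s : Set G // s ∈ 𝓝 (1 : G)}),
      ∃ t : {s : Set G // s ∈ 𝓝 (1 : G)}, t.1 ⊆ U n ∧ closure t.1 ⊆ s.1 ∧
        ∀ a ∈ t.1, ∀ b ∈ t.1, a⁻¹ * b ∈ s.1 := by
    rintro n ⟨s, hs⟩
    obtain ⟨C, ⟨hC, hCc⟩, hCs⟩ := (closed_nhds_basis (1 : G)).mem_iff.1 hs
    have hdiv : Tendsto (fun p : G × G => p.1⁻¹ * p.2) (𝓝 1 ×ˢ 𝓝 1) (𝓝 1) := by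
      have : Continuous fun p : G × G => p.1⁻¹ * p.2 := by fun_prop
      simpa [nhds_prod_eq] using this.tendsto (1, 1)
    obtain ⟨D, hD, hDs⟩ := mem_prod_same_iff.1 (hdiv hs)
    refine ⟨⟨U n ∩ C ∩ D, inter_mem (inter_mem ((h.isOpen n).mem_nhds (h.subset n h1)) hC) hD⟩,
      fun x hx => hx.1.1, ?_, fun a ha b hb => hDs (mk_mem_prod ha.2 hb.2)⟩
    exact (closure_minimal (fun x hx => hx.1.2) hCc).trans hCs
  choose next hnextU hnextc hnext using step
  let W : ℕ → {s : Set G // s ∈ 𝓝 (1 : G)} := fun n => Nat.rec ⟨univ, univ_mem⟩ next n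
  have hWU : ∀ n, (W (n + 1)).1 ⊆ U n := fun n => hnextU n (W n)
  have hWc : ∀ n, closure (W (n + 1)).1 ⊆ (W n).1 := fun n => hnextc n (W n)
  have hWm : ∀ n, ∀ a ∈ (W (n + 1)).1, ∀ b ∈ (W (n + 1)).1, a⁻¹ * b ∈ (W n).1 :=
    fun n => hnext n (W n)
  have hWanti : Antitone fun n => (W n).1 := antitone_of_closure_succ_subset hWc
  have hHc : IsClosed (⋂ n, (W n).1) := isClosed_iInter_of_closure_succ_subset hWc
  have hHQ : ⋂ n, (W n).1 ⊆ Q := by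
    intro y hy
    by_contra hyQ
    obtain ⟨n, hn⟩ := h.exists_subset isOpen_compl_singleton (subset_compl_singleton_iff.2 hyQ)
    exact hn (hWU n (mem_iInter.1 hy (n + 1))) rfl
  have hHK : IsCompact (⋂ n, (W n).1) := h.isCompact.of_isClosed_subset hHc hHQ
  have hbase : ∀ O : Set G, IsOpen O → ⋂ n, (W n).1 ⊆ O → ∃ n, (W n).1 ⊆ O := by
    intro O hO hHO
    obtain ⟨n, hn⟩ : ∃ n, Q ∩ closure (W n).1 ⊆ O := by
      obtain ⟨n, hn⟩ := exists_subset_nhds_of_isCompact' (V := fun n => Q ∩ closure (W n).1)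
        (Antitone.directed_ge fun m n hmn => inter_subset_inter_right _ (closure_mono (hWanti hmn)))
        (fun n => h.isCompact.inter_right isClosed_closure)
        (fun n => h.isCompact.isClosed.inter isClosed_closure) (U := O)
        fun x hx => hO.mem_nhds <| hHO <| mem_iInter.2 fun n => hWc n (mem_iInter.1 hx (n + 1)).2
      exact ⟨n, hn⟩
    obtain ⟨m, hm⟩ := h.exists_subset
      (hO.union (isClosed_closure (s := (W n).1)).isOpen_compl) fun x hx => by
        by_cases hxW : x ∈ closure (W n).1
        · exact Or.inl (hn ⟨hx, hxW⟩)
        · exact Or.inr hxW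
    refine ⟨max (m + 1) n, fun x hx => ?_⟩
    have hxm : x ∈ U m := hWU m (hWanti (le_max_left (m + 1) n) hx)
    have hxn : x ∈ (W n).1 := hWanti (le_max_right (m + 1) n) hx
    exact (hm hxm).resolve_right fun hc => hc (subset_closure hxn)
  choose S hSc hScov using fun n => exists_countable_translates_cover hcc (W (n + 1)).2
  refine ⟨isLindelof_of_countable_subcover fun {ι} O hO hcov => ?_⟩
  have hfin : ∀ g : G, ∃ (n : ℕ) (t : Finset ι), ∀ w ∈ (W n).1, g * w ∈ ⋃ i ∈ t, O i := by
    intro g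
    obtain ⟨t, ht⟩ := (hHK.image (continuous_const_mul g)).elim_finite_subcover O hO
      ((subset_univ _).trans hcov)
    obtain ⟨n, hn⟩ := hbase ((fun y => g * y) ⁻¹' ⋃ i ∈ t, O i)
      ((isOpen_biUnion fun i _ => hO i).preimage (continuous_const_mul g)) (image_subset_iff.1 ht)
    exact ⟨n, t, fun w hw => hn hw⟩
  choose n t ht using hfin
  -- `g m s` is a point near `s` whose finite subcover works at scale `m`, if there is one.
  have hsel : ∀ (m : ℕ) (s : G), ∃ g : G,
      (∃ x, n x = m ∧ s⁻¹ * x ∈ (W (m + 1)).1) → n g = m ∧ s⁻¹ * g ∈ (W (m + 1)).1 := by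
    intro m s
    by_cases hx : ∃ x, n x = m ∧ s⁻¹ * x ∈ (W (m + 1)).1
    · exact ⟨hx.choose, fun _ => hx.choose_spec⟩
    · exact ⟨1, fun hx' => absurd hx' hx⟩
  choose g hg using hsel
  refine ⟨⋃ m, ⋃ s ∈ S m, (t (g m s) : Set ι), ?_, fun x _ => ?_⟩
  · exact countable_iUnion fun m => (hSc m).biUnion fun s _ => (t (g m s)).countable_toSet
  · obtain ⟨s, hs, hsx⟩ := hScov (n x) x
    obtain ⟨hgn, hgs⟩ := hg (n x) s ⟨x, rfl, hsx⟩
    have hmem := ht (g (n x) s) ((g (n x) s)⁻¹ * x) (by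
      rw [hgn]
      convert hWm (n x) _ hgs _ hsx using 1
      group)
    rw [mul_inv_cancel_left] at hmem
    obtain ⟨i, hi, hxi⟩ := mem_iUnion₂.1 hmem
    exact mem_biUnion (mem_iUnion.2 ⟨n x, mem_biUnion hs hi⟩) hxi

/-- A point of `X` in the intersection of nested open sets of a compactification, whose trace on the
remainder is closed, lies in a compact subset of `X` of countable character. -/
theorem exists_isCompactWithBase_of_mem_iInter {X bX : Type*} [TopologicalSpace X]
    [TopologicalSpace bX] [CompactSpace bX] [T2Space bX] {f : X → bX} (hf : IsEmbedding f)
    {K : Set bX} {V : ℕ → Set bX} (hK : IsClosed K) (hKs : K ⊆ (range f)ᶜ)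
    (hVo : ∀ n, IsOpen (V n)) (hVK : (⋂ n, V n) \ K ⊆ range f) {x : X} (hx : f x ∈ ⋂ n, V n) :
    ∃ (Q : Set X) (U : ℕ → Set X), IsCompactWithBase Q U ∧ x ∈ Q := by
  have hxK : f x ∉ K := fun hxK => hKs hxK ⟨x, rfl⟩
  obtain ⟨R, hRo, hxR, hRV, hR⟩ := exists_nested_open_nhds (isClosed_singleton (x := f x))
    (fun n => V n ∩ Kᶜ) (fun n => (hVo n).inter hK.isOpen_compl)
    (fun n => singleton_subset_iff.2 ⟨mem_iInter.1 hx n, hxK⟩)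
  have hRf : ⋂ n, R n ⊆ range f := fun y hy => hVK
    ⟨mem_iInter.2 fun n => (hRV n (mem_iInter.1 hy n)).1, (hRV 0 (mem_iInter.1 hy 0)).2⟩
  refine ⟨f ⁻¹' ⋂ n, R n, fun n => f ⁻¹' R n, ⟨?_, ?_, ?_, ?_, ?_⟩,
    mem_iInter.2 fun n => hxR n rfl⟩
  · exact hf.isInducing.isCompact_preimage'
      (isClosed_iInter_of_closure_succ_subset hR).isCompact hRf
  · exact fun n => (hRo n).preimage hf.continuous
  · exact fun n => preimage_mono (iInter_subset _ n)
  · exact fun m n hmn => preimage_mono (antitone_of_closure_succ_subset hR hmn)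
  · intro O hO hQO
    obtain ⟨O', hO', rfl⟩ := hf.isInducing.isOpen_iff.1 hO
    obtain ⟨n, hn⟩ := exists_subset_of_iInter_subset hR hO' fun y hy => by
      obtain ⟨z, rfl⟩ := hRf hy
      exact hQO hy
    exact ⟨n, preimage_mono hn⟩

theorem IsCompactWithBase.preimage_homeomorph {X Y : Type*} [TopologicalSpace X]
    [TopologicalSpace Y] {Q : Set Y} {U : ℕ → Set Y} (h : IsCompactWithBase Q U) (e : X ≃ₜ Y) :
    IsCompactWithBase (e ⁻¹' Q) fun n => e ⁻¹' U n where
  isCompact := e.isCompact_preimage.2 h.isCompact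
  isOpen n := (h.isOpen n).preimage e.continuous
  subset n := preimage_mono (h.subset n)
  antitone _ _ hmn := preimage_mono (h.antitone hmn)
  exists_subset {O} hO hQ := by
    obtain ⟨n, hn⟩ := h.exists_subset (e.isOpenMap O hO) fun y hy =>
      ⟨e.symm y, hQ (by simpa using hy), e.apply_symm_apply y⟩
    exact ⟨n, fun x hx => by
      obtain ⟨z, hz, hzx⟩ := hn hx
      exact e.injective hzx ▸ hz⟩

theorem interior_eq_empty_of_not_locallyCompactSpace {G : Type*} [Group G] [TopologicalSpace G]
    [ContinuousMul G] [R1Space G] (hnlc : ¬ LocallyCompactSpace G) {K : Set G}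
    (hK : IsCompact K) : interior K = ∅ := by
  by_contra! hne
  obtain ⟨x, hx⟩ := hne
  refine hnlc ?_
  have : WeaklyLocallyCompactSpace G := ⟨fun y => by
    refine ⟨Homeomorph.mulLeft (x * y⁻¹) ⁻¹' K,
      (Homeomorph.mulLeft (x * y⁻¹)).isCompact_preimage.2 hK, ?_⟩
    refine (Homeomorph.mulLeft (x * y⁻¹)).continuous.continuousAt ?_
    simpa using mem_interior_iff_mem_nhds.1 hx⟩
  infer_instance

/-- Suppose `G` is a non-locally compact, k-gentle Tychonoff paratopological
group (inversion maps compact sets to compact sets), and `Y = bG \ G` is the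
remainder of `G` in a Hausdorff compactification `bG` of `G` (here `G` is
embedded densely into the compact Hausdorff space `bG` via `f`). Then `Y` is
of subcountable type if and only if `Y` is of countable type. -/
theorem remainder_subcountableType_iff_countableType {G bG : Type*}
    [Group G] [TopologicalSpace G] [ContinuousMul G] [T35Space G]
    [TopologicalSpace bG] [CompactSpace bG] [T2Space bG]
    (f : G → bG) (hf : Topology.IsEmbedding f) (hd : DenseRange f)
    (hnlc : ¬ LocallyCompactSpace G)
    (hk : ∀ F : Set G, IsCompact F → IsCompact ((fun x : G => x⁻¹) '' F)) :
    SubcountableType ((Set.range f)ᶜ : Set bG) ↔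
      CountableType ((Set.range f)ᶜ : Set bG) := by
  refine ⟨fun h => ?_, CountableType.subcountableType⟩
  by_cases hQ : ∃ (Q : Set G) (U : ℕ → Set G), IsCompactWithBase Q U ∧ Q.Nonempty
  · obtain ⟨Q, U, hQU, x, hx⟩ := hQ
    have hQU' := hQU.preimage_homeomorph (Homeomorph.mulLeft x)
    have h1 : (1 : G) ∈ Homeomorph.mulLeft x ⁻¹' Q := by simpa using hx
    have : ContinuousInv G := hQU'.continuousInv hk h1
    have : IsTopologicalGroup G := {}
    have : LindelofSpace G := hQU'.lindelofSpace h1 fun S V hV hne hlf =>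
      h.countable_of_locallyFinite hf
        (fun K hK => interior_eq_empty_of_not_locallyCompactSpace hnlc hK) hV hne hlf
    exact countableType_compl_of_isLindelof (isLindelof_range hf.continuous)
  · refine countableType_of_exists_nested fun F hF hFs => ?_
    obtain ⟨K, V, hK, hFK, hKs, hVo, hKV, hV, hVK⟩ := h.exists_nested hF hFs
    refine ⟨V, hVo, fun n => hFK.trans (hKV n), hV, ?_⟩
    rintro _ hy ⟨x, rfl⟩
    obtain ⟨Q, U, hQU, hxQ⟩ := exists_isCompactWithBase_of_mem_iInter hf hK hKs hVo
      (by simpa using hVK) hy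
    exact hQ ⟨Q, U, hQU, x, hxQ⟩
end

section
/- Suppose that G is a non-locally compact, k-gentle Tychonoff paratopological group, and Y = bG \ G is the remainder of G in some Hausdorff compactification bG of G. If Y is κ-perfect, then Y is first-countable. -/
open Filter Topology Set

/-- If `y` is relatively `Gδ` in `Y ∪ {y}` and every decreasing sequence of nonempty open sets
accumulates at a point of `Y`, then `y` has a countable neighborhood base relative to `Y`. -/
theorem isCountablyGenerated_nhdsWithin_of_accumulation {X : Type*} [TopologicalSpace X]
    [RegularSpace X] {Y : Set X} {y : X} {U : ℕ → Set X} (hU : ∀ n, U n ∈ 𝓝 y)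
    (hUY : ∀ z ∈ Y, (∀ n, z ∈ U n) → z = y)
    (hacc : ∀ V : ℕ → Set X, Antitone V → (∀ n, IsOpen (V n)) → (∀ n, (V n).Nonempty) →
      ∃ z ∈ Y, ∀ n, z ∈ closure (V n)) :
    (𝓝[Y] y).IsCountablyGenerated := by
  choose C hCy hCc hCU using fun n => exists_mem_nhds_isClosed_subset (hU n)
  set W : ℕ → Set X := fun n => interior (⋂ k ∈ Finset.range (n + 1), C k)
  have hWy : ∀ n, W n ∈ 𝓝 y := fun n =>
    interior_mem_nhds.2 ((Filter.biInter_finset_mem _).2 fun k _ => hCy k)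
  have hWanti : Antitone W := fun m n hmn => interior_mono <|
    biInter_subset_biInter_left fun k hk => by
      have := Finset.mem_range.1 hk
      exact Finset.mem_range.2 (by omega)
  have hWC : ∀ n, W n ⊆ C n := fun n =>
    interior_subset.trans (biInter_subset_of_mem (Finset.mem_range.2 n.lt_succ_self))
  have hbasis : (𝓝[Y] y).HasBasis (fun _ : ℕ => True) fun n => W n ∩ Y := by
    refine ⟨fun s => ⟨fun hs => ?_, fun ⟨n, _, hn⟩ => mem_of_superset
      (inter_mem (mem_nhdsWithin_of_mem_nhds (hWy n)) self_mem_nhdsWithin) hn⟩⟩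
    obtain ⟨O, hO, hOs⟩ := mem_nhdsWithin_iff_exists_mem_nhds_inter.1 hs
    obtain ⟨D, hDy, hDc, hDO⟩ := exists_mem_nhds_isClosed_subset hO
    by_contra! hcon
    obtain ⟨z, hzY, hz⟩ := hacc (fun n => W n \ D)
      (fun m n hmn => sdiff_subset_sdiff_left (hWanti hmn))
      (fun n => isOpen_interior.sdiff hDc) fun n => by
        obtain ⟨w, hw, hws⟩ := not_subset.1 (hcon n trivial)
        exact ⟨w, hw.1, fun hwD => hws (hOs ⟨hDO hwD, hw.2⟩)⟩
    have hzy : z = y := hUY z hzY fun n =>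
      hCU n (closure_minimal (sdiff_subset.trans (hWC n)) (hCc n) (hz n))
    obtain ⟨w, hwD, hw⟩ := mem_closure_iff_nhds.1 (hzy ▸ hz 0) D hDy
    exact hw.2 hwD
  exact HasCountableBasis.isCountablyGenerated ⟨hbasis, to_countable _⟩

/-- A compact set together with a sequence converging to it is compact. -/
theorem IsCompact.union_range_of_eventually {X : Type*} [TopologicalSpace X] {P : Set X}
    (hP : IsCompact P) {t : ℕ → X}
    (ht : ∀ U, IsOpen U → P ⊆ U → ∀ᶠ n in atTop, t n ∈ U) : IsCompact (P ∪ range t) := by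
  classical
  refine isCompact_of_finite_subcover fun {ι} U hUo hU => ?_
  obtain ⟨s, hs⟩ := hP.elim_finite_subcover U hUo (subset_union_left.trans hU)
  obtain ⟨N, hN⟩ := eventually_atTop.1
    (ht _ (isOpen_biUnion fun i _ => hUo i) hs)
  choose j hj using fun n => mem_iUnion.1 (hU (Or.inr ⟨n, rfl⟩ : t n ∈ P ∪ range t))
  refine ⟨s ∪ (Finset.range N).image j, union_subset (hs.trans ?_) ?_⟩
  · exact biUnion_subset_biUnion_left fun i hi => Finset.mem_union_left _ hi
  · rintro _ ⟨n, rfl⟩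
    rcases le_or_gt N n with h | h
    · exact biUnion_subset_biUnion_left
        (fun i hi => Finset.mem_union_left _ hi) (hN n h)
    · exact mem_biUnion (Finset.mem_coe.2 <| Finset.mem_union_right _ <|
        Finset.mem_image_of_mem _ (Finset.mem_range.2 h)) (hj n)

/-- In a k-gentle paratopological group, if some decreasing sequence of nonempty open sets converges
to a compact set, then some decreasing sequence of neighborhoods of `1` does. -/
theorem exists_nhds_one_converging_to_compact {G : Type*} [Group G] [TopologicalSpace G]
    [ContinuousMul G]
    (hk : ∀ F : Set G, IsCompact F → IsCompact ((fun x : G => x⁻¹) '' F))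
    {W : ℕ → Set G} (hWanti : Antitone W) (hWo : ∀ n, IsOpen (W n)) (hWne : ∀ n, (W n).Nonempty)
    {F : Set G} (hF : IsCompact F) (hWF : ∀ U, IsOpen U → F ⊆ U → ∃ n, W n ⊆ U) :
    ∃ (P : Set G) (O : ℕ → Set G), IsCompact P ∧ Antitone O ∧ (∀ n, O n ∈ 𝓝 1) ∧
      ∀ U, IsOpen U → P ⊆ U → ∃ n, O n ⊆ U := by
  choose a ha using hWne
  have hK : IsCompact (F ∪ range a) := hF.union_range_of_eventually fun U hU hFU => by
    obtain ⟨n, hn⟩ := hWF U hU hFU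
    exact eventually_atTop.2 ⟨n, fun m hm => hn (hWanti hm (ha m))⟩
  set L := (fun x : G => x⁻¹) '' (F ∪ range a)
  have hLc : IsCompact L := hk _ hK
  refine ⟨(fun p : G × G => p.1 * p.2) '' (L ×ˢ F),
    fun n => ⋂ k ∈ Finset.range (n + 1), (fun x => a k * x) ⁻¹' W k,
    (hLc.prod hF).image continuous_mul, fun m n hmn => ?_, fun n => ?_, fun U hU hPU => ?_⟩
  · refine biInter_subset_biInter_left fun k hk => ?_
    have := Finset.mem_range.1 hk
    exact Finset.mem_range.2 (by omega)
  · refine (Filter.biInter_finset_mem _).2 fun k _ => ?_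
    exact ((hWo k).preimage (continuous_const_mul (a k))).mem_nhds (by simpa using ha k)
  · obtain ⟨A, B, -, hB, hLA, hFB, hAB⟩ := generalized_tube_lemma hLc hF
      (hU.preimage continuous_mul) (image_subset_iff.1 hPU)
    obtain ⟨n, hn⟩ := hWF B hB hFB
    refine ⟨n, fun x hx => ?_⟩
    have hx' : a n * x ∈ W n := mem_iInter₂.1 hx n (Finset.mem_range.2 n.lt_succ_self)
    have : ((a n)⁻¹, a n * x) ∈ A ×ˢ B :=
      ⟨hLA ⟨a n, Or.inr ⟨n, rfl⟩, rfl⟩, hn hx'⟩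
    simpa using hAB this

/-- A k-gentle paratopological group in which `1` lies in a compact set approximated by a sequence
of neighborhoods of `1` is a topological group. -/
theorem isTopologicalGroup_of_kGentle {G : Type*} [Group G] [TopologicalSpace G]
    [ContinuousMul G] [T3Space G]
    (hk : ∀ F : Set G, IsCompact F → IsCompact ((fun x : G => x⁻¹) '' F))
    {P : Set G} {O : ℕ → Set G} (hP : IsCompact P) (hOanti : Antitone O) (hO : ∀ n, O n ∈ 𝓝 1)
    (hOP : ∀ U, IsOpen U → P ⊆ U → ∃ n, O n ⊆ U) : IsTopologicalGroup G := by
  have hinv : Tendsto (fun x : G => x⁻¹) (𝓝 1) (𝓝 1) := by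
    intro N hN
    wlog hNo : IsOpen N generalizing N
    · obtain ⟨N', hN', hN'o, h1⟩ := mem_nhds_iff.1 hN
      exact mem_of_superset (this (hN'o.mem_nhds h1) hN'o) (preimage_mono hN')
    set T : Set G := (fun x : G => x⁻¹) ⁻¹' Nᶜ with hT
    have hTc : ∀ Q, IsCompact Q → IsCompact (T ∩ Q) := fun Q hQ => by
      have h := hk _ ((hk Q hQ).inter_left hNo.isClosed_compl)
      convert h using 1
      ext x
      simp [hT]
    have h1T : (1 : G) ∉ T := by simpa [hT] using mem_of_mem_nhds hN
    obtain ⟨D, hD1, hDc, hDT⟩ := exists_mem_nhds_isClosed_subset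
      ((hTc P hP).isClosed.isOpen_compl.mem_nhds (fun h => h1T h.1 : (1 : G) ∈ (T ∩ P)ᶜ))
    by_contra hcon
    have hex : ∀ n, ∃ t, t ∈ T ∧ t ∈ O n ∧ t ∈ D := fun n => by
      by_contra! h
      refine hcon (mem_map.2 (mem_of_superset (inter_mem (hO n) hD1) fun x hx => ?_))
      by_contra hxN
      exact h x hxN hx.1 hx.2
    choose t htT htO htD using hex
    have htP : ∀ U, IsOpen U → P ⊆ U → ∀ᶠ n in atTop, t n ∈ U := fun U hU hPU => by
      obtain ⟨n, hn⟩ := hOP U hU hPU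
      exact eventually_atTop.2 ⟨n, fun m hm => hn (hOanti hm (htO m))⟩
    obtain ⟨z, ⟨⟨hzT, -⟩, hzD⟩, hz⟩ :=
      ((hTc _ (hP.union_range_of_eventually htP)).inter_right hDc).exists_clusterPt
      (f := map t atTop) (le_principal_iff.2 <| mem_map.2 <| univ_mem'
        fun n => ⟨⟨htT n, Or.inr ⟨n, rfl⟩⟩, htD n⟩)
    refine hDT hzD ⟨hzT, ?_⟩
    by_contra hzP
    obtain ⟨A, B, hA, hB, hPA, hzB, hAB⟩ := SeparatedNhds.of_isCompact_isCompact hP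
      (isCompact_singleton (x := z)) (disjoint_singleton_right.2 hzP)
    obtain ⟨w, hwB, hwA⟩ := clusterPt_iff_nonempty.1 hz
      (hB.mem_nhds (hzB rfl)) (mem_map.2 (htP A hA hPA))
    exact hAB.le_bot ⟨hwA, hwB⟩
  refine IsTopologicalGroup.of_nhds_one ?_ hinv (fun x => ?_) fun x => ?_
  · simpa [nhds_prod_eq, Function.uncurry_def] using (continuous_mul (M := G)).tendsto (1, 1)
  · simpa using ((Homeomorph.mulLeft x).map_nhds_eq 1).symm
  · simpa using ((continuous_const_mul x).mul_const x⁻¹).tendsto 1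

/-- For a symmetric `U` containing `1` there is a left `U`-separated set `A` with `A * U = G`. -/
theorem exists_maximal_leftSeparated {G : Type*} [Group G] {U : Set G} (h1 : (1 : G) ∈ U)
    (hsymm : ∀ x ∈ U, x⁻¹ ∈ U) :
    ∃ A : Set G, A.Pairwise (fun a b => a⁻¹ * b ∉ U) ∧ ∀ x, ∃ a ∈ A, a⁻¹ * x ∈ U := by
  obtain ⟨A, hA⟩ := zorn_subset {A : Set G | A.Pairwise fun a b => a⁻¹ * b ∉ U}
    fun c hc hchain => ⟨⋃₀ c, (pairwise_sUnion hchain.directedOn).2 hc,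
      fun s hs => subset_sUnion_of_mem hs⟩
  refine ⟨A, hA.prop, fun x => ?_⟩
  by_contra! h
  have hins : insert x A ∈ {A : Set G | A.Pairwise fun a b => a⁻¹ * b ∉ U} :=
    hA.prop.insert fun b hb _ => ⟨fun hx => h b hb (by simpa using hsymm _ hx), h b hb⟩
  exact h x (hA.le_of_ge hins (subset_insert x A) (mem_insert x A)) (by simpa using h1)

/-- If `G` is a topological group with a dense `κ`-perfect remainder, then `G` is `ω`-narrow. -/
theorem exists_countable_cover_of_kappaPerfect_remainder {G bG : Type*}
    [Group G] [TopologicalSpace G] [IsTopologicalGroup G]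
    [TopologicalSpace bG] [CompactSpace bG] {f : G → bG} (hf : IsEmbedding f)
    (hd : DenseRange f) (hY : Dense (range f)ᶜ)
    (hperf : ∀ F : Set ((range f)ᶜ : Set bG), IsCompact F → IsGδ F)
    {U : Set G} (hU : U ∈ 𝓝 1) :
    ∃ A : Set G, A.Countable ∧ ∀ x, ∃ a ∈ A, a⁻¹ * x ∈ U := by
  classical
  obtain ⟨S, hS, hSU⟩ := exists_nhds_split_inv (inter_mem hU (inv_mem_nhds_one G hU))
  obtain ⟨A, hA, hAU⟩ := exists_maximal_leftSeparated (U := U ∩ U⁻¹)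
    ⟨mem_of_mem_nhds hU, by simpa using mem_of_mem_nhds hU⟩
    fun x hx => ⟨hx.2, by simpa using hx.1⟩
  refine ⟨A, ?_, fun x => (hAU x).imp fun a ha => ⟨ha.1, ha.2.1⟩⟩
  obtain ⟨R, hR, hRS⟩ := exists_nhds_split_inv hS
  obtain ⟨V, hVR, hVo, hV1⟩ := mem_nhds_iff.1 hR
  -- each translate of `V` meets at most one of the sets `a • V`, `a ∈ A`
  have hdisc : ∀ x, ∀ a ∈ A, ∀ b ∈ A, ∀ g h, x⁻¹ * g ∈ V → a⁻¹ * g ∈ V → x⁻¹ * h ∈ V →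
      b⁻¹ * h ∈ V → a = b := by
    intro x a ha b hb g h hxg hag hxh hbh
    by_contra hab
    refine hA ha hb hab ?_
    have h1 := hRS _ (hVR hag) _ (hVR hxg)
    have h2 := hRS _ (hVR hbh) _ (hVR hxh)
    have := hSU _ h1 _ h2
    convert this using 1
    simp only [div_eq_mul_inv]
    group
  have hopen : ∀ x : G, ∃ O : Set bG, IsOpen O ∧ f ⁻¹' O = {g | x⁻¹ * g ∈ V} := fun x =>
    hf.isInducing.isOpen_iff.1 (hVo.preimage (continuous_const_mul x⁻¹))
  choose O hOo hOV using hopen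
  have hOf : ∀ x g, f g ∈ O x ↔ x⁻¹ * g ∈ V := fun x g => Set.ext_iff.1 (hOV x) g
  set C : Finset G → Set bG := fun s => closure (⋃ a ∈ A \ s, f '' {g | a⁻¹ * g ∈ V})
  have hCdir : Directed (· ⊇ ·) C := fun s t => ⟨s ∪ t,
    closure_mono (biUnion_subset_biUnion_left fun a ha => ⟨ha.1, fun h => ha.2 (by simp_all)⟩),
    closure_mono (biUnion_subset_biUnion_left fun a ha => ⟨ha.1, fun h => ha.2 (by simp_all)⟩)⟩
  have hmem : ∀ s : Finset G, ∀ z ∈ C s, ∀ x, z ∈ O x →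
      ∃ a ∈ A, a ∉ s ∧ ∃ g, a⁻¹ * g ∈ V ∧ x⁻¹ * g ∈ V := by
    intro s z hz x hx
    obtain ⟨w, hwO, hw⟩ := mem_closure_iff.1 hz (O x) (hOo x) hx
    obtain ⟨a, ⟨haA, has⟩, g, hg, rfl⟩ := mem_iUnion₂.1 hw
    exact ⟨a, haA, has, g, hg, (hOf x g).1 hwO⟩
  have hE : ⋂ s, C s ⊆ (range f)ᶜ := by
    rintro _ hz ⟨x, rfl⟩
    have hx : f x ∈ O x := (hOf x x).2 (by simpa using hV1)
    obtain ⟨a, ha, -, g, hg, hxg⟩ := hmem ∅ _ (mem_iInter.1 hz ∅) x hx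
    obtain ⟨b, hb, hba, h, hh, hxh⟩ := hmem {a} _ (mem_iInter.1 hz {a}) x hx
    exact hba (by simpa using (hdisc x a ha b hb g h hxg hg hxh hh).symm)
  have hEc : IsCompact ((↑) ⁻¹' ⋂ s, C s : Set ((range f)ᶜ : Set bG)) :=
    IsInducing.subtypeVal.isCompact_preimage'
      (isClosed_iInter fun s => isClosed_closure).isCompact (by rwa [Subtype.range_coe])
  obtain ⟨Q, hQo, hQ⟩ := isGδ_iff_eq_iInter_nat.1 (hperf _ hEc)
  choose Q' hQ'o hQ' using fun n => isOpen_induced_iff.1 (hQo n)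
  have hEQ : ∀ z (hz : z ∈ (range f)ᶜ), z ∈ ⋂ s, C s ↔ ∀ n, z ∈ Q' n := fun z hz => by
    have := Set.ext_iff.1 hQ ⟨z, hz⟩
    simpa [← hQ'] using this
  have hs : ∀ n, ∃ s, C s ⊆ Q' n := fun n =>
    exists_subset_nhds_of_compactSpace hCdir (fun _ => isClosed_closure)
      fun z hz => (hQ'o n).mem_nhds ((hEQ z (hE hz)).1 hz n)
  choose s hs using hs
  refine (countable_iUnion fun n => (s n).countable_toSet).mono fun a ha => ?_
  by_contra has
  obtain ⟨y, hyO, hyY⟩ := hY.inter_open_nonempty (O a) (hOo a)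
    ⟨f a, (hOf a a).2 (by simpa using hV1)⟩
  have hycl : y ∈ closure (f '' {g | a⁻¹ * g ∈ V}) := by
    refine closure_mono ?_ (hd.open_subset_closure_inter (hOo a) hyO)
    rintro _ ⟨hg, g, rfl⟩
    exact ⟨g, (hOf a g).1 hg, rfl⟩
  have hyE : y ∈ ⋂ s, C s := (hEQ y hyY).2 fun n => hs n <|
    closure_mono (subset_biUnion_of_mem (u := fun a => f '' {g | a⁻¹ * g ∈ V})
      (show a ∈ A \ s n from ⟨ha, fun h => has (mem_iUnion.2 ⟨n, h⟩)⟩)) hycl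
  obtain ⟨b, hb, hba, g, hg, hag⟩ := hmem {a} y (mem_iInter.1 hyE {a}) a hyO
  exact hba (by simpa using (hdisc a a ha b hb g g hag hag hag hg).symm)

/-- The remainder of a non-locally compact paratopological group is dense. -/
theorem dense_compl_range_of_not_locallyCompact {G bG : Type*}
    [Group G] [TopologicalSpace G] [ContinuousMul G] [T2Space G]
    [TopologicalSpace bG] [CompactSpace bG] [T2Space bG] {f : G → bG} (hf : IsEmbedding f)
    (hd : DenseRange f) (hnlc : ¬ LocallyCompactSpace G) : Dense (range f)ᶜ := by
  rw [← interior_eq_empty_iff_dense_compl, ← not_nonempty_iff_eq_empty]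
  intro hne
  obtain ⟨_, hx, x, rfl⟩ := hd.inter_open_nonempty _ isOpen_interior hne
  obtain ⟨K, hK, hKs, hKc⟩ := local_compact_nhds (mem_interior_iff_mem_nhds.1 hx)
  have hKG : IsCompact (f ⁻¹' K) := hf.isInducing.isCompact_preimage' hKc hKs
  have hKx : f ⁻¹' K ∈ 𝓝 x := hf.continuous.continuousAt hK
  have : WeaklyLocallyCompactSpace G := ⟨fun g => by
    refine ⟨_, hKG.image (continuous_const_mul (g * x⁻¹)), ?_⟩
    have := (Homeomorph.mulLeft (g * x⁻¹)).map_nhds_eq x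
    simp only [Homeomorph.coe_mulLeft, inv_mul_cancel_right] at this
    rw [← this]
    exact image_mem_map hKx⟩
  exact hnlc inferInstance

/-- Suppose `G` is a non-locally compact, k-gentle Tychonoff paratopological
group (inversion maps compact sets to compact sets), and `Y = bG \ G` is the
remainder of `G` in a Hausdorff compactification `bG` of `G` (here `G` is
embedded densely into the compact Hausdorff space `bG` via `f`). If `Y` is
κ-perfect (every compact subspace of `Y` is a Gδ-set in `Y`), then `Y` is
first-countable. -/
theorem remainder_kappaPerfect_firstCountable {G bG : Type*}
    [Group G] [TopologicalSpace G] [ContinuousMul G] [T35Space G]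
    [TopologicalSpace bG] [CompactSpace bG] [T2Space bG]
    (f : G → bG) (hf : Topology.IsEmbedding f) (hd : DenseRange f)
    (hnlc : ¬ LocallyCompactSpace G)
    (hk : ∀ F : Set G, IsCompact F → IsCompact ((fun x : G => x⁻¹) '' F))
    (hperf : ∀ F : Set ((Set.range f)ᶜ : Set bG), IsCompact F → IsGδ F) :
    FirstCountableTopology ((Set.range f)ᶜ : Set bG) := by
  have hY := dense_compl_range_of_not_locallyCompact hf hd hnlc
  refine ⟨fun y => ?_⟩
  suffices h : (𝓝[(range f)ᶜ] (y : bG)).IsCountablyGenerated by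
    rw [nhds_subtype_eq_comap_nhdsWithin]
    infer_instance
  obtain ⟨Q, hQo, hQ⟩ := isGδ_iff_eq_iInter_nat.1 (hperf {y} isCompact_singleton)
  choose U hUo hUQ using fun n => isOpen_induced_iff.1 (hQo n)
  have hUmem : ∀ z : ((range f)ᶜ : Set bG), z = y ↔ ∀ n, (z : bG) ∈ U n := fun z => by
    have := Set.ext_iff.1 hQ z
    simpa [← hUQ] using this
  have hUy : ∀ n, U n ∈ 𝓝 (y : bG) := fun n => (hUo n).mem_nhds ((hUmem y).1 rfl n)
  have hUY : ∀ z ∈ (range f)ᶜ, (∀ n, z ∈ U n) → z = y := fun z hz h =>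
    congrArg Subtype.val ((hUmem ⟨z, hz⟩).2 h)
  by_cases hacc : ∀ V : ℕ → Set bG, Antitone V → (∀ n, IsOpen (V n)) → (∀ n, (V n).Nonempty) →
      ∃ z ∈ (range f)ᶜ, ∀ n, z ∈ closure (V n)
  · exact isCountablyGenerated_nhdsWithin_of_accumulation hUy hUY hacc
  push Not at hacc
  obtain ⟨V, hVanti, hVo, hVne, hV⟩ := hacc
  have hVF : ⋂ n, closure (V n) ⊆ range f := fun z hz => by
    by_contra hzf
    obtain ⟨n, hn⟩ := hV z hzf
    exact hn (mem_iInter.1 hz n)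
  obtain ⟨P, O, hP, hOanti, hO, hOP⟩ := exists_nhds_one_converging_to_compact hk
    (W := fun n => f ⁻¹' V n) (fun m n hmn => preimage_mono (hVanti hmn))
    (fun n => (hVo n).preimage hf.continuous)
    (fun n => by
      obtain ⟨_, hx, x, rfl⟩ := hd.inter_open_nonempty _ (hVo n) (hVne n)
      exact ⟨x, hx⟩)
    (hf.isInducing.isCompact_preimage' (isClosed_iInter fun n => isClosed_closure).isCompact hVF)
    (fun U hU hFU => by
      obtain ⟨U', hU', rfl⟩ := hf.isInducing.isOpen_iff.1 hU
      obtain ⟨n, hn⟩ := exists_subset_nhds_of_compactSpace (V := fun n => closure (V n))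
        (Antitone.directed_ge fun m n hmn => closure_mono (hVanti hmn))
        (fun _ => isClosed_closure) fun z hz => hU'.mem_nhds (by
          obtain ⟨x, rfl⟩ := hVF hz
          exact hFU hz)
      exact ⟨n, preimage_mono (subset_closure.trans hn)⟩)
  have : IsTopologicalGroup G := isTopologicalGroup_of_kGentle hk hP hOanti hO hOP
  have hM : ∀ n, ∃ M ∈ 𝓝 (1 : G), ∀ v ∈ M, ∀ w ∈ M, v⁻¹ * w ∈ O n := fun n => by
    obtain ⟨M, hM, h⟩ := exists_nhds_split_inv (hO n)
    exact ⟨M⁻¹, inv_mem_nhds_one G hM, fun v hv w hw => by simpa using h _ hv _ hw⟩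
  choose M hM1 hMO using hM
  choose A hAc hA using fun n =>
    exists_countable_cover_of_kappaPerfect_remainder hf hd hY hperf (hM1 n)
  -- countably many closed sets missing `y` cover the image of `G`
  have hcover : ∀ x, ∃ n, ∃ a ∈ A n, a⁻¹ * x ∈ M n ∧
      (y : bG) ∉ closure (f '' {g | a⁻¹ * g ∈ M n}) := fun x => by
    obtain ⟨S, T, hS, hT, hPS, hyT, hST⟩ := SeparatedNhds.of_isCompact_isCompact
      (hP.image (hf.continuous.comp (continuous_const_mul x)))
      (isCompact_singleton (x := (y : bG)))
      (disjoint_singleton_right.2 fun ⟨p, _, hp⟩ => y.2 ⟨x * p, hp⟩)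
    obtain ⟨n, hn⟩ := hOP _ (hS.preimage (hf.continuous.comp (continuous_const_mul x)))
      (image_subset_iff.1 hPS)
    obtain ⟨a, ha, hax⟩ := hA n x
    refine ⟨n, a, ha, hax, fun hy => ?_⟩
    obtain ⟨_, hgT, g, hg, rfl⟩ := mem_closure_iff.1 hy T hT (hyT rfl)
    have hgS : f (x * ((a⁻¹ * x)⁻¹ * (a⁻¹ * g))) ∈ S := hn (hMO n _ hax _ hg)
    exact hST.le_bot ⟨by simpa using hgS, hgT⟩
  set I : Set (ℕ × G) := ⋃ n, (fun a => (n, a)) ''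
    {a ∈ A n | (y : bG) ∉ closure (f '' {g | a⁻¹ * g ∈ M n})}
  have hIc : I.Countable := countable_iUnion fun n => ((hAc n).mono (sep_subset _ _)).image _
  have hIne : I.Nonempty := by
    obtain ⟨n, a, ha, -, hy⟩ := hcover 1
    exact ⟨(n, a), mem_iUnion.2 ⟨n, a, ⟨ha, hy⟩, rfl⟩⟩
  obtain ⟨e, he⟩ := hIc.exists_eq_range hIne
  have hyB : ∀ k, (y : bG) ∉ closure (f '' {g | (e k).2⁻¹ * g ∈ M (e k).1}) := fun k => by
    obtain ⟨n, a, ⟨-, ha⟩, hk⟩ := mem_iUnion.1 (he ▸ mem_range_self k : e k ∈ I)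
    rw [← hk]
    exact ha
  have : (𝓝[univ] (y : bG)).IsCountablyGenerated :=
    isCountablyGenerated_nhdsWithin_of_accumulation
      (U := fun k => U k ∩ (closure (f '' {g | (e k).2⁻¹ * g ∈ M (e k).1}))ᶜ)
      (fun k => inter_mem (hUy k) (isClosed_closure.isOpen_compl.mem_nhds (hyB k)))
      (fun z _ hz => by
        refine hUY z ?_ fun n => (hz n).1
        rintro ⟨x, rfl⟩
        obtain ⟨n, a, ha, hax, hy⟩ := hcover x
        obtain ⟨k, hk⟩ : (n, a) ∈ range e := he ▸ mem_iUnion.2 ⟨n, a, ⟨ha, hy⟩, rfl⟩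
        refine (hz k).2 (subset_closure ⟨x, ?_, rfl⟩)
        rw [hk]
        exact hax)
      fun W hW _ hWne => by
        obtain ⟨z, hz⟩ := IsCompact.nonempty_iInter_of_sequence_nonempty_isCompact_isClosed
          (fun n => closure (W n)) (fun n => closure_mono (hW n.le_succ))
          (fun n => (hWne n).closure) isClosed_closure.isCompact fun n => isClosed_closure
        exact ⟨z, mem_univ z, mem_iInter.1 hz⟩
  rw [nhdsWithin_univ] at this
  rw [nhdsWithin]
  infer_instance
end
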